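/- arXiv:1907.03199 — 9 statements merged into one kernel-verified Lean document; each statement's English description precedes it below -/
import Mathlib

section
/- For every countable type Σ and every LOCAL algorithm (A_ℓ)_{ℓ≥1} with state type Σ, there exist an injection e : Σ → ℝ and a real-state message-passing GNN (Msg_ℓ, Up_ℓ)_{ℓ≥1} with input encoding e such that for every n ∈ ℕ, every attributed graph on n nodes over Σ, every layer ℓ ≥ 0, and every node i ∈ Fin n, the GNN state equals the encoded LOCAL state: x_i(ℓ) = e (s_i(ℓ)). (Direction 'for any LOCAL algorithm there exists an equivalent GNN' of the Equivalence Theorem between message-passing GNNs and the LOCAL model.) -/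
/-- The closed neighborhood `N*(i) = {i} ∪ {j | G.Adj i j}` of a node, as a `Finset`. -/
noncomputable def Nstar {n : ℕ} (G : SimpleGraph (Fin n)) (i : Fin n) : Finset (Fin n) := by
  classical exact Finset.univ.filter (fun j => j = i ∨ G.Adj i j)

/-- The state `x_i(ℓ)` of a real-state message-passing GNN with messaging functions
`Msg`, update functions `Up` and input encoding `e`, run on the attributed graph
`(G, a, β)` on `n` nodes.  Node identifiers are the casts of `Fin n` to `ℕ`. -/
noncomputable def gnnState {n : ℕ} {α : Type*}
    (Msg : ℕ → ℝ × ℝ × ℕ × ℕ × ℕ → ℝ) (Up : ℕ → ℝ → ℝ) (e : α → ℝ)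
    (G : SimpleGraph (Fin n)) (a : Fin n → α) (β : Fin n → Fin n → ℕ) :
    ℕ → Fin n → ℝ
  | 0, i => e (a i)
  | (ℓ+1), i => Up (ℓ+1) (∑ j ∈ Nstar G i,
      Msg (ℓ+1) (gnnState Msg Up e G a β ℓ i, gnnState Msg Up e G a β ℓ j,
        (i : ℕ), (j : ℕ), β i j))

/-- The state `s_i(ℓ)` of a LOCAL algorithm `A` with state type `α`, run on the
attributed graph `(G, a, β)` on `n` nodes. -/
noncomputable def localState {n : ℕ} {α : Type*}
    (A : ℕ → Multiset (α × ℕ × ℕ) × ℕ → α)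
    (G : SimpleGraph (Fin n)) (a : Fin n → α) (β : Fin n → Fin n → ℕ) :
    ℕ → Fin n → α
  | 0, i => a i
  | (ℓ+1), i => A (ℓ+1) (((Nstar G i).val).map
      (fun j => (localState A G a β ℓ j, (j : ℕ), β i j)), (i : ℕ))

/-- A finite set of codable items, packed into one real number as a sum of powers of two. -/
noncomputable def binaryCode {τ : Type*} [Encodable τ] (S : Finset τ) : ℝ :=
  ∑ t ∈ S, (2 : ℝ) ^ Encodable.encode t

theorem binaryCode_injective {τ : Type*} [Encodable τ] :
    Function.Injective (binaryCode (τ := τ)) := by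
  intro S T h
  apply Finset.map_injective ⟨Encodable.encode, Encodable.encode_injective⟩
  apply Finset.geomSum_injective le_rfl
  have h' : ∑ t ∈ S, (2 : ℝ) ^ Encodable.encode t = ∑ t ∈ T, (2 : ℝ) ^ Encodable.encode t := h
  simp only [Finset.sum_map, Function.Embedding.coeFn_mk]
  exact_mod_cast h'

theorem self_mem_Nstar {n : ℕ} (G : SimpleGraph (Fin n)) (i : Fin n) : i ∈ Nstar G i := by
  simp [Nstar]

/-- **Equivalence Theorem, LOCAL → GNN direction.**  For every countable state type `α`
and every LOCAL algorithm `A`, there exist an injective input encoding `e : α → ℝ` and a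
real-state message-passing GNN `(Msg, Up)` such that on every attributed graph on `n`
nodes over `α`, at every layer `ℓ` and node `i`, the GNN state equals the encoded LOCAL
state: `x_i(ℓ) = e (s_i(ℓ))`. -/
theorem local_to_gnn_equivalence (α : Type) [Countable α]
    (A : ℕ → Multiset (α × ℕ × ℕ) × ℕ → α) :
    ∃ e : α → ℝ, Function.Injective e ∧
      ∃ (Msg : ℕ → ℝ × ℝ × ℕ × ℕ × ℕ → ℝ) (Up : ℕ → ℝ → ℝ),
        ∀ (n : ℕ) (G : SimpleGraph (Fin n)) (a : Fin n → α) (β : Fin n → Fin n → ℕ)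
          (ℓ : ℕ) (i : Fin n),
          gnnState Msg Up e G a β ℓ i = e (localState A G a β ℓ i) := by
  have : Encodable α := Encodable.ofCountable α
  let e : α → ℝ := fun s => (Encodable.encode s : ℝ)
  have he : Function.Injective e := Nat.cast_injective.comp Encodable.encode_injective
  refine ⟨e, he,
    fun _ m => Function.extend e
      (fun s => (2 : ℝ) ^ Encodable.encode (m.2.2.1, s, m.2.2.2.1, m.2.2.2.2)) 0 m.2.1,
    fun ℓ => Function.extend binaryCode
      (fun S : Finset (ℕ × α × ℕ × ℕ) => e (A ℓ (S.val.map Prod.snd, S.sup Prod.fst))) 0, ?_⟩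
  intro n G a β ℓ
  induction ℓ with
  | zero => intro i; rfl
  | succ ℓ ih =>
    intro i
    let f : Fin n ↪ ℕ × α × ℕ × ℕ :=
      ⟨fun j => ((i : ℕ), localState A G a β ℓ j, (j : ℕ), β i j), fun j k h => by
        simp only [Prod.mk.injEq] at h
        exact Fin.ext h.2.2.1⟩
    have hsum : ∑ j ∈ Nstar G i, (2 : ℝ) ^ Encodable.encode
        ((i : ℕ), localState A G a β ℓ j, (j : ℕ), β i j) =
          binaryCode ((Nstar G i).map f) := by
      rw [binaryCode, Finset.sum_map]
      rfl
    have hsup : ((Nstar G i).map f).sup Prod.fst = (i : ℕ) := by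
      rw [Finset.sup_map]
      exact Finset.sup_const ⟨i, self_mem_Nstar G i⟩ _
    have hval : ((Nstar G i).map f).val.map Prod.snd =
        (Nstar G i).val.map (fun j => (localState A G a β ℓ j, (j : ℕ), β i j)) := by
      rw [Finset.map_val, Multiset.map_map]
      rfl
    simp only [gnnState, localState, ih, he.extend_apply]
    rw [hsum, binaryCode_injective.extend_apply, hsup, hval]
end

section
/- For every countable type X there exists a function f : X → ℝ such that the map from Multiset X to ℝ sending a multiset S to the sum (S.map f).sum is injective; that is, sum aggregation after a suitable element-wise encoding loses no information about a finite multiset over a countable domain. -/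
open Polynomial in
theorem coeff_multiset_sum_map_X_pow {X : Type*} [DecidableEq X] {e : X → ℕ}
    (he : Function.Injective e) (S : Multiset X) (x : X) :
    ((S.map fun y => (Polynomial.X : ℤ[X]) ^ e y).sum).coeff (e x) = S.count x := by
  induction S using Multiset.induction_on with
  | empty => simp
  | cons y S ih => simp [ih, coeff_X_pow, Multiset.count_cons, he.eq_iff, add_comm]

open Polynomial in
theorem injective_multiset_sum_map_X_pow {X : Type*} {e : X → ℕ}
    (he : Function.Injective e) :
    Function.Injective fun S : Multiset X =>
      (S.map fun y => (Polynomial.X : ℤ[X]) ^ e y).sum := by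
  classical
  intro S T h
  ext x
  have hx := congrArg (fun p : ℤ[X] => p.coeff (e x)) h
  simpa only [coeff_multiset_sum_map_X_pow he, Nat.cast_inj] using hx

/-- **Injectivity of sum aggregation after a suitable encoding.**  For every countable
type `X` there is a function `f : X → ℝ` such that the map sending a finite multiset `S`
over `X` to the real number `(S.map f).sum` is injective: sum aggregation after a
suitable element-wise encoding loses no information about the multiset. -/
theorem multiset_sum_encoding_injective (X : Type) [Countable X] :
    ∃ f : X → ℝ, Function.Injective (fun S : Multiset X => (S.map f).sum) := by
  obtain ⟨e, he⟩ := exists_injective_nat X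
  have ht := transcendental_iff_injective.mp (transcendental_liouvilleNumber le_rfl)
  refine ⟨fun x => liouvilleNumber (2 : ℕ) ^ e x, ?_⟩
  convert ht.comp (injective_multiset_sum_map_X_pow he) using 2 with S
  simp [map_multiset_sum]
end

section
/- For every countable type X, every type Y, and every function h : Multiset X → Y, there exist functions f : X → ℝ and φ : ℝ → Y such that h S = φ ((S.map f).sum) for every multiset S over X; that is, every multiset (aggregation) function over a countable domain factors as an element-wise map followed by summation followed by a final map. -/
/-- The sum of the logarithms determines a multiset of primes. -/
theorem Multiset.sum_map_log_primes_injective :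
    Function.Injective
      fun S : Multiset Nat.Primes => (S.map fun p : Nat.Primes => Real.log (p.1 : ℝ)).sum := by
  have pos (S : Multiset Nat.Primes) : 0 < (S.map fun p : Nat.Primes => p.1).prod :=
    Nat.pos_of_ne_zero <| Multiset.prod_ne_zero fun h0 => by
      obtain ⟨p, -, hp⟩ := Multiset.mem_map.1 h0
      exact p.2.ne_zero hp
  have log_prod (S : Multiset Nat.Primes) :
      (S.map fun p : Nat.Primes => Real.log (p.1 : ℝ)).sum
        = Real.log (((S.map fun p : Nat.Primes => p.1).prod : ℕ) : ℝ) := by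
    induction S using Multiset.induction_on with
    | empty => simp
    | cons p S ih =>
      simp only [Multiset.map_cons, Multiset.sum_cons, Multiset.prod_cons, ih, Nat.cast_mul]
      rw [Real.log_mul (mod_cast p.2.ne_zero) (mod_cast (pos S).ne')]
  have factors (S : Multiset Nat.Primes) :
      UniqueFactorizationMonoid.normalizedFactors (S.map fun p : Nat.Primes => p.1).prod
        = S.map fun p : Nat.Primes => p.1 := by
    refine UniqueFactorizationMonoid.normalizedFactors_prod_of_prime fun q hq => ?_
    obtain ⟨p, -, rfl⟩ := Multiset.mem_map.1 hq
    exact p.2.prime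
  intro S T hST
  simp only [log_prod] at hST
  have hprod : (S.map fun p : Nat.Primes => p.1).prod = (T.map fun p : Nat.Primes => p.1).prod :=
    mod_cast Real.log_injOn_pos (Set.mem_Ioi.2 (mod_cast pos S))
      (Set.mem_Ioi.2 (mod_cast pos T)) hST
  refine Multiset.map_injective Subtype.val_injective ?_
  have := congrArg UniqueFactorizationMonoid.normalizedFactors hprod
  rwa [factors, factors] at this

/-- **Decomposition of multiset functions.**  For every countable type `X`, every type
`Y`, and every function `h` on finite multisets over `X`, there are functions `f : X → ℝ`
and `φ : ℝ → Y` such that `h S = φ ((S.map f).sum)` for every multiset `S`: every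
aggregation function over a countable domain factors as an element-wise map followed by
summation followed by a final map. -/
theorem multiset_function_decomposition (X : Type) [Countable X] (Y : Type)
    (h : Multiset X → Y) :
    ∃ (f : X → ℝ) (φ : ℝ → Y), ∀ S : Multiset X, h S = φ ((S.map f).sum) := by
  obtain ⟨e, he⟩ := exists_injective_nat X
  let g : X → Nat.Primes := Infinite.natEmbedding Nat.Primes ∘ e
  have hg : Function.Injective g := (Infinite.natEmbedding Nat.Primes).injective.comp he
  have hinj : Function.Injective
      fun S : Multiset X => (S.map fun x => Real.log ((g x).1 : ℝ)).sum := by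
    simpa [Function.comp_def, Multiset.map_map] using
      Multiset.sum_map_log_primes_injective.comp (Multiset.map_injective hg)
  exact ⟨_, Function.extend _ h fun _ => h 0, fun S => (hinj.extend_apply h _ S).symm⟩
end

section
/- Fix n ≥ 2 and c ∈ ℕ. Consider the unbounded-message variant of a CONGEST algorithm, in which messages take values in an arbitrary type T (message functions M_ℓ : Σ × Fin n → T and update functions U_ℓ : Multiset (T × ℕ) × Fin n → Σ). For every such algorithm of d rounds whose state type Σ has cardinality at most 2^c, there exists a (c + ⌈log₂ n⌉)-bit CONGEST algorithm of d rounds with the same state type Σ and the same initialization such that on every n-node input, the states of the two algorithms coincide at every round ℓ ≤ d and every node. (Key lemma in the proof of the lower-bound transfer theorem: a state bound of c bits implies messages can be bounded by c + log₂ n bits, by sending the state together with the sender's identifier and letting the receiver recompute the message.) -/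
/-- The state `s_i(ℓ)` of a CONGEST-style algorithm with state type `St`, node-attribute
type `S₀`, and message type `T` (take `T := Fin (2^b)` for the `b`-bit CONGEST model),
given by an initialization `init`, message functions `M` and update functions `U`,
run on the attributed graph `(G, a, β)` on `n` nodes. -/
noncomputable def congestState {n : ℕ} {S₀ St T : Type*}
    (init : S₀ × Fin n → St)
    (M : ℕ → St × Fin n → T)
    (U : ℕ → Multiset (T × ℕ) × Fin n → St)
    (G : SimpleGraph (Fin n)) (a : Fin n → S₀) (β : Fin n → Fin n → ℕ) :
    ℕ → Fin n → St
  | 0, i => init (a i, i)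
  | (ℓ+1), i => U (ℓ+1) (((Nstar G i).val).map
      (fun j => (M (ℓ+1) (congestState init M U G a β ℓ j, j), β i j)), i)

/-- If every pair of a state and a node identifier can be decoded from its encoding, then sending
the encoded pair and letting the receiver recompute the message leaves all states unchanged. -/
theorem congestState_encode {n : ℕ} {S₀ St T T' : Type*}
    (enc : St × Fin n → T') (dec : T' → St × Fin n) (h : Function.LeftInverse dec enc)
    (init : S₀ × Fin n → St) (M : ℕ → St × Fin n → T)
    (U : ℕ → Multiset (T × ℕ) × Fin n → St)
    (G : SimpleGraph (Fin n)) (a : Fin n → S₀) (β : Fin n → Fin n → ℕ) (ℓ : ℕ) (i : Fin n) :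
    congestState init (fun _ => enc)
      (fun k p => U k (p.1.map (Prod.map (fun t => M k (dec t)) id), p.2)) G a β ℓ i =
      congestState init M U G a β ℓ i := by
  induction ℓ generalizing i with
  | zero => simp only [congestState]
  | succ k ih =>
    simp only [congestState, Multiset.map_map, Function.comp_def, Prod.map_apply, h _, ih, id_eq]

/-- A state of `c` bits and an identifier of a node fit into `c + ⌈log₂ n⌉` bits. -/
theorem nonempty_state_node_embedding {n c : ℕ} {St : Type*} (emb : St ↪ Fin (2 ^ c)) :
    Nonempty (St × Fin n ↪ Fin (2 ^ (c + Nat.clog 2 n))) := by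
  have hle : n ≤ 2 ^ Nat.clog 2 n := Nat.le_pow_clog one_lt_two n
  rw [pow_add]
  exact ⟨(emb.prodMap (Fin.castLEEmb hle)).trans finProdFinEquiv.toEmbedding⟩

/-- **Bounding messages by the state size.**  Fix `n ≥ 2` and `c`.  For every
unbounded-message CONGEST algorithm of `d` rounds (messages in an arbitrary type `T`)
whose state type `St` embeds into `Fin (2^c)` (i.e. has cardinality at most `2^c`),
there exists a `(c + ⌈log₂ n⌉)`-bit CONGEST algorithm of `d` rounds with the same state
type and the same initialization whose states coincide with those of the original
algorithm at every round `ℓ ≤ d` and every node, on every `n`-node input. -/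
theorem congest_bounded_messages_of_bounded_state
    (n c : ℕ) (hn : 2 ≤ n) (S₀ St T : Type) (emb : St ↪ Fin (2^c))
    (d : ℕ)
    (init : S₀ × Fin n → St)
    (M : ℕ → St × Fin n → T)
    (U : ℕ → Multiset (T × ℕ) × Fin n → St) :
    ∃ (M' : ℕ → St × Fin n → Fin (2^(c + Nat.clog 2 n)))
      (U' : ℕ → Multiset (Fin (2^(c + Nat.clog 2 n)) × ℕ) × Fin n → St),
      ∀ (G : SimpleGraph (Fin n)) (a : Fin n → S₀) (β : Fin n → Fin n → ℕ)
        (ℓ : ℕ), ℓ ≤ d → ∀ i : Fin n,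
        congestState init M' U' G a β ℓ i = congestState init M U G a β ℓ i := by
  obtain ⟨e⟩ := nonempty_state_node_embedding (n := n) emb
  have i₀ : Fin n := ⟨0, by omega⟩
  have : Nonempty (St × Fin n) := ⟨(U 0 (0, i₀), i₀)⟩
  exact ⟨fun _ => e, _, fun G a β ℓ _ i => congestState_encode e (Function.invFun e)
    (Function.leftInverse_invFun e.injective) init M U G a β ℓ i⟩
end

section
/- For every odd k ≥ 5 there exists a constant c > 0 such that for infinitely many n ∈ ℕ the following holds: for all d, w, p ∈ ℕ with p ≥ 1, every finite-precision message-passing GNN of depth d, width w, and precision p that, for some out : S → Bool, decides the predicate 'G contains a k-cycle' over all n-node inputs with identically-zero node and edge attributes, satisfies d · (w·p + ⌈log₂ n⌉) ≥ c · n. (Cycle-detection lower bound for odd cycles: dw = Ω(n / log n).) -/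
/-- The state `x_i(ℓ)` of a finite-precision message-passing GNN of width `w` and
precision `p`, with messaging functions `Msg` and update functions `Up`, run on the
attributed graph `(G, a, β)` on `n` nodes.  The messages are summed pointwise in
`Fin w → ℝ` after the coordinatewise natural-number-cast embedding `ι`. -/
noncomputable def fpState {n w p : ℕ}
    (Msg : ℕ → (Fin w → Fin (2^p)) × (Fin w → Fin (2^p)) × Fin n × Fin n × ℕ →
      (Fin w → Fin (2^p)))
    (Up : ℕ → (Fin w → ℝ) → (Fin w → Fin (2^p)))
    (G : SimpleGraph (Fin n)) (a : Fin n → Fin w → Fin (2^p)) (β : Fin n → Fin n → ℕ) :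
    ℕ → Fin n → Fin w → Fin (2^p)
  | 0, i => a i
  | (ℓ+1), i => Up (ℓ+1) (∑ j ∈ Nstar G i, fun k =>
      ((Msg (ℓ+1) (fpState Msg Up G a β ℓ i, fpState Msg Up G a β ℓ j, i, j, β i j)) k : ℝ))

/-- The identically-zero finite-precision node attribute. -/
noncomputable def zeroS (w p : ℕ) : Fin w → Fin (2^p) := fun _ => ⟨0, by positivity⟩

/-- `G` contains a cycle of length `k`: there are a vertex `v` and a closed walk from `v`
to `v` that is a cycle of length `k`. -/
def hasCycleOfLength {n : ℕ} (G : SimpleGraph (Fin n)) (k : ℕ) : Prop :=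
  ∃ (v : Fin n) (c : G.Walk v v), c.IsCycle ∧ c.length = k

section LayeredGraph

variable {k N : ℕ}

/-- A directed arc from a layer to the cyclically next one: `X` prescribes the arcs leaving
layer `0`, `Y` those leaving layer `2` (with the coordinates swapped), and all other pairs of
consecutive layers are joined by the identity matching. -/
def LayerArc (X Y : Set (Fin N × Fin N)) (a b : Fin k × Fin N) : Prop :=
  (b.1 : ℕ) = ((a.1 : ℕ) + 1) % k ∧
    ((a.1 : ℕ) = 0 → (a.2, b.2) ∈ X) ∧
    ((a.1 : ℕ) = 2 → (b.2, a.2) ∈ Y) ∧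
    ((a.1 : ℕ) ≠ 0 → (a.1 : ℕ) ≠ 2 → a.2 = b.2)

/-- The blow-up of the `k`-cycle whose edges are the arcs of `LayerArc X Y`. -/
def layeredGraph (X Y : Set (Fin N × Fin N)) : SimpleGraph (Fin (k * N)) :=
  (SimpleGraph.fromRel (LayerArc (k := k) X Y)).comap finProdFinEquiv.symm

theorem layeredGraph_adj (X Y : Set (Fin N × Fin N)) (a b : Fin (k * N)) :
    (layeredGraph X Y).Adj a b ↔ a ≠ b ∧
      (LayerArc (k := k) X Y (finProdFinEquiv.symm a) (finProdFinEquiv.symm b) ∨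
        LayerArc (k := k) X Y (finProdFinEquiv.symm b) (finProdFinEquiv.symm a)) := by
  simp only [layeredGraph, SimpleGraph.comap_adj, SimpleGraph.fromRel_adj, ne_eq,
    EmbeddingLike.apply_eq_iff_eq]

/-- A closed sequence of `k` arcs passes once through every layer, and hence exhibits a common
element of `X` and `Y`. -/
theorem inter_nonempty_of_closed_arcs (hk : 5 ≤ k) {X Y : Set (Fin N × Fin N)}
    (h : ℕ → Fin k × Fin N) (hc : h k = h 0)
    (ha : ∀ t < k, LayerArc X Y (h t) (h (t + 1))) : (X ∩ Y).Nonempty := by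
  have hmod : ∀ t, LayerArc X Y (h (t % k)) (h ((t + 1) % k)) := by
    intro t
    have hlt : t % k < k := Nat.mod_lt _ (by omega)
    have hs := ha _ hlt
    rcases Nat.lt_or_ge (t % k + 1) k with h1 | h1
    · rwa [Nat.add_mod t 1 k, Nat.mod_eq_of_lt (show 1 < k by omega), Nat.mod_eq_of_lt h1]
    · have h2 : t % k + 1 = k := by omega
      rw [Nat.add_mod t 1 k, Nat.mod_eq_of_lt (show 1 < k by omega), h2, Nat.mod_self, ← hc]
      rwa [h2] at hs
  have hlayer : ∀ t, ((h (t % k)).1 : ℕ) = ((h 0).1 + t) % k := by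
    intro t
    induction t with
    | zero => simp [Nat.mod_eq_of_lt (h 0).1.isLt]
    | succ t ih => rw [(hmod t).1, ih, Nat.mod_add_mod, Nat.add_assoc]
  obtain ⟨g, hg, hgk, hgl⟩ : ∃ g : ℕ → Fin k × Fin N,
      (∀ t, LayerArc X Y (g t) (g (t + 1))) ∧ g k = g 0 ∧ ∀ t < k, ((g t).1 : ℕ) = t := by
    refine ⟨fun t => h ((k - (h 0).1 + t) % k), fun t => hmod _, by simp, fun t ht => ?_⟩
    have hlt := (h 0).1.isLt
    simp only [hlayer]
    rw [← Nat.add_assoc, Nat.add_sub_cancel' hlt.le, Nat.add_mod_left, Nat.mod_eq_of_lt ht]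
  have hX := (hg 0).2.1 (hgl 0 (by omega))
  have h12 := (hg 1).2.2.2 (by rw [hgl 1 (by omega)]; omega) (by rw [hgl 1 (by omega)]; omega)
  have hY := (hg 2).2.2.1 (hgl 2 (by omega))
  have hrest : ∀ s, s + 3 ≤ k → (g (s + 3)).2 = (g 3).2 := by
    intro s
    induction s with
    | zero => simp
    | succ s ih =>
      intro hs
      have hl := hgl (s + 3) (by omega)
      rw [← ih (by omega)]
      exact ((hg (s + 3)).2.2.2 (by omega) (by omega)).symm
  have hlast := hrest (k - 3) (by omega)
  rw [Nat.sub_add_cancel (by omega), hgk] at hlast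
  refine ⟨((g 0).2, (g 1).2), hX, ?_⟩
  rw [hlast, h12]
  exact hY

theorem inter_nonempty_of_hasCycleOfLength (hk : 5 ≤ k) (hko : Odd k)
    {X Y : Set (Fin N × Fin N)}
    (hcyc : hasCycleOfLength (layeredGraph (k := k) X Y) k) : (X ∩ Y).Nonempty := by
  classical
  obtain ⟨v, c, -, hlen⟩ := hcyc
  let h : ℕ → Fin k × Fin N := fun t => finProdFinEquiv.symm (c.getVert t)
  have hclosed : h k = h 0 := by
    simp only [h, SimpleGraph.Walk.getVert_zero]
    rw [c.getVert_of_length_le hlen.le]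
  have hadj : ∀ t < k, LayerArc X Y (h t) (h (t + 1)) ∨ LayerArc X Y (h (t + 1)) (h t) :=
    fun t ht => ((layeredGraph_adj X Y _ _).1 (c.adj_getVert_succ (ht.trans_eq hlen.symm))).2
  let fwd : ℕ → Prop := fun t => LayerArc X Y (h t) (h (t + 1))
  have hcount : ∀ t ≤ k, ((h t).1 : ℤ) ≡ (h 0).1 + 2 * Nat.count fwd t - t [ZMOD k] := by
    intro t
    induction t with
    | zero => intro _; simp [Int.ModEq.refl]
    | succ t ih =>
      intro ht
      have ih := ih (by omega)
      rw [Nat.count_succ]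
      split_ifs with hf
      · have h1 : ((h (t + 1)).1 : ℤ) ≡ (h t).1 + 1 [ZMOD k] := by
          rw [hf.1]; push_cast; exact Int.mod_modEq _ _
        refine h1.trans ((ih.add_right 1).trans ?_)
        push_cast
        ring_nf
        rfl
      · have hb := (hadj t (by omega)).resolve_left hf
        have h1 : ((h t).1 : ℤ) ≡ (h (t + 1)).1 + 1 [ZMOD k] := by
          rw [hb.1]; push_cast; exact Int.mod_modEq _ _
        have h2 := (h1.symm.trans ih).sub_right 1
        rw [add_sub_cancel_right] at h2
        refine h2.trans ?_
        push_cast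
        ring_nf
        rfl
  have hdvd : k ∣ Nat.count fwd k := by
    have h1 := (hcount k le_rfl).dvd
    rw [hclosed] at h1
    have h2 : (k : ℤ) ∣ 2 * Nat.count fwd k := by
      have h3 := h1.add (dvd_refl (k : ℤ))
      ring_nf at h3 ⊢
      exact h3
    have h3 : k ∣ 2 * Nat.count fwd k := by exact_mod_cast h2
    exact (Nat.coprime_two_right.2 hko).dvd_of_dvd_mul_left h3
  have hle : Nat.count fwd k ≤ k := Nat.count_le _
  rcases Nat.eq_zero_or_pos (Nat.count fwd k) with h0 | hpos
  · have hnot : ∀ t < k, ¬ fwd t := fun t ht => Nat.count_iff_forall_not.1 h0 t ht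
    refine inter_nonempty_of_closed_arcs hk (fun t => h (k - t)) (by simpa using hclosed.symm) ?_
    intro t ht
    have hb := (hadj (k - (t + 1)) (by omega)).resolve_left (hnot _ (by omega))
    rwa [show k - (t + 1) + 1 = k - t by omega] at hb
  · have heq : Nat.count fwd k = k := le_antisymm hle (Nat.le_of_dvd hpos hdvd)
    exact inter_nonempty_of_closed_arcs hk h hclosed
      fun t ht => Nat.count_iff_forall.1 heq t ht

theorem hasCycleOfLength_of_inter_nonempty (hk : 5 ≤ k) {X Y : Set (Fin N × Fin N)}
    (hXY : (X ∩ Y).Nonempty) : hasCycleOfLength (layeredGraph (k := k) X Y) k := by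
  obtain ⟨⟨i, j⟩, hX, hY⟩ := hXY
  let f : Fin k → Fin k × Fin N := fun t => (t, if (t : ℕ) = 1 ∨ (t : ℕ) = 2 then j else i)
  have hf : Function.Injective f := fun s t hst => congrArg Prod.fst hst
  have harc : ∀ s t : Fin k, (t - s).val = 1 → LayerArc X Y (f s) (f t) := by
    intro s t hst
    have hs := s.isLt
    have ht := t.isLt
    have hval : (t : ℕ) = ((s : ℕ) + 1) % k := by
      rw [Fin.val_sub] at hst
      rcases le_or_gt (s : ℕ) t with h | h
      · rw [show k - (s : ℕ) + t = (t - s) + k by omega, Nat.add_mod_right,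
          Nat.mod_eq_of_lt (by omega)] at hst
        rw [Nat.mod_eq_of_lt (by omega)]
        omega
      · rw [Nat.mod_eq_of_lt (by omega)] at hst
        rw [show (s : ℕ) + 1 = k by omega, Nat.mod_self]
        omega
    refine ⟨hval, fun h0 => ?_, fun h2 => ?_, fun h0 h2 => ?_⟩
    · have h0' : (s : ℕ) = 0 := h0
      have h1 : (t : ℕ) = 1 := by rw [hval, h0']; exact Nat.mod_eq_of_lt (by omega)
      simpa [f, h0', h1] using hX
    · have h2' : (s : ℕ) = 2 := h2
      have h1 : (t : ℕ) = 3 := by rw [hval, h2']; exact Nat.mod_eq_of_lt (by omega)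
      simpa [f, h2', h1] using hY
    · change (s : ℕ) ≠ 0 at h0
      change (s : ℕ) ≠ 2 at h2
      simp only [f]
      rcases Nat.lt_or_ge ((s : ℕ) + 1) k with h | h
      · rw [Nat.mod_eq_of_lt h] at hval
        congr 1
        apply propext
        omega
      · rw [show (s : ℕ) + 1 = k by omega, Nat.mod_self] at hval
        rw [if_neg (by omega), if_neg (by omega)]
  refine (SimpleGraph.cycleGraph_isContained_iff (by omega)).1
    ⟨⟨⟨fun t => finProdFinEquiv (f t), fun {s t} hst => ?_⟩,
      finProdFinEquiv.injective.comp hf⟩⟩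
  rw [layeredGraph_adj]
  refine ⟨fun he => hst.ne (hf (finProdFinEquiv.injective he)), ?_⟩
  simp only [Equiv.symm_apply_apply]
  rw [SimpleGraph.cycleGraph_adj'] at hst
  exact hst.symm.imp (harc s t) (harc t s)

theorem hasCycleOfLength_layeredGraph_iff (hk : 5 ≤ k) (hko : Odd k)
    (X Y : Set (Fin N × Fin N)) :
    hasCycleOfLength (layeredGraph (k := k) X Y) k ↔ (X ∩ Y).Nonempty :=
  ⟨inter_nonempty_of_hasCycleOfLength hk hko, hasCycleOfLength_of_inter_nonempty hk⟩

/-- Every closed neighborhood of `layeredGraph X Y` depends on only one of `X` and `Y`. -/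
theorem layeredGraph_Nstar_local (hk : 5 ≤ k) (X Y X' Y' : Set (Fin N × Fin N))
    (v : Fin (k * N)) :
    Nstar (layeredGraph (k := k) X Y') v = Nstar (layeredGraph X Y) v ∨
      Nstar (layeredGraph (k := k) X Y') v = Nstar (layeredGraph X' Y') v := by
  have hsucc : ∀ a b : Fin k × Fin N, (b.1 : ℕ) = ((a.1 : ℕ) + 1) % k →
      (b.1 : ℕ) = a.1 + 1 ∨ ((b.1 : ℕ) = 0 ∧ (a.1 : ℕ) + 1 = k) := by
    intro a b h
    have ha := a.1.isLt
    rcases Nat.lt_or_ge ((a.1 : ℕ) + 1) k with h1 | h1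
    · rw [Nat.mod_eq_of_lt h1] at h; exact Or.inl h
    · have h2 : (a.1 : ℕ) + 1 = k := by omega
      rw [h2, Nat.mod_self] at h
      exact Or.inr ⟨h, h2⟩
  have hcongr : ∀ (X₁ Y₁ X₂ Y₂ : Set (Fin N × Fin N)),
      (∀ b, (LayerArc (k := k) X₁ Y₁ (finProdFinEquiv.symm v) b ↔
        LayerArc X₂ Y₂ (finProdFinEquiv.symm v) b) ∧
        (LayerArc (k := k) X₁ Y₁ b (finProdFinEquiv.symm v) ↔
        LayerArc X₂ Y₂ b (finProdFinEquiv.symm v))) →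
      Nstar (layeredGraph (k := k) X₁ Y₁) v = Nstar (layeredGraph X₂ Y₂) v := by
    intro X₁ Y₁ X₂ Y₂ h
    ext u
    simp only [Nstar, Finset.mem_filter, layeredGraph_adj, (h _).1, (h _).2]
  set a : Fin k × Fin N := finProdFinEquiv.symm v with ha
  by_cases hl : (a.1 : ℕ) = 0 ∨ (a.1 : ℕ) = 1
  · refine Or.inl (hcongr _ _ _ _ fun b => ⟨and_congr_right fun h => ?_,
      and_congr_right fun h => ?_⟩)
    · have : (a.1 : ℕ) ≠ 2 := by omega
      simp [this]
    · have : (b.1 : ℕ) ≠ 2 := by have := hsucc _ _ h; omega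
      simp [this]
  · refine Or.inr (hcongr _ _ _ _ fun b => ⟨and_congr_right fun h => ?_,
      and_congr_right fun h => ?_⟩)
    · have : (a.1 : ℕ) ≠ 0 := by omega
      simp [this]
    · have : (b.1 : ℕ) ≠ 0 := by have := hsucc _ _ h; omega
      simp [this]

end LayeredGraph

/-- If two graphs produce the same states in all rounds, then so does every graph each of whose
closed neighborhoods agrees with the one in either of them. -/
theorem fpState_eq_of_Nstar_eq_or {n w p : ℕ}
    {Msg : ℕ → (Fin w → Fin (2^p)) × (Fin w → Fin (2^p)) × Fin n × Fin n × ℕ →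
      (Fin w → Fin (2^p))}
    {Up : ℕ → (Fin w → ℝ) → (Fin w → Fin (2^p))}
    {a : Fin n → Fin w → Fin (2^p)} {β : Fin n → Fin n → ℕ}
    {G₁ G₂ H : SimpleGraph (Fin n)}
    (hH : ∀ v, Nstar H v = Nstar G₁ v ∨ Nstar H v = Nstar G₂ v) {d : ℕ}
    (hG : ∀ ℓ < d, fpState Msg Up G₁ a β (ℓ + 1) = fpState Msg Up G₂ a β (ℓ + 1)) :
    ∀ ℓ ≤ d, fpState Msg Up H a β ℓ = fpState Msg Up G₁ a β ℓ := by
  intro ℓ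
  induction ℓ with
  | zero => intro _; rfl
  | succ ℓ ih =>
    intro hℓ
    have ih₁ := ih (by omega)
    have h₁₂ : fpState Msg Up G₁ a β ℓ = fpState Msg Up G₂ a β ℓ := by
      cases ℓ with
      | zero => rfl
      | succ m => exact hG m (by omega)
    funext v
    rcases hH v with h | h
    · simp only [fpState, h, ih₁]
    · rw [hG ℓ (by omega)]
      simp only [fpState, h, ih₁, h₁₂]

/-- The fooling-set argument: the histories of the disjoint instances `(X, Xᶜ)` are pairwise
distinct, so there are at least `2 ^ (N * N)` of them. -/
theorem sq_le_of_decides_cycle {k N d w p : ℕ} (hk : 5 ≤ k) (hko : Odd k)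
    (Msg : ℕ → (Fin w → Fin (2^p)) × (Fin w → Fin (2^p)) × Fin (k * N) × Fin (k * N) × ℕ →
      (Fin w → Fin (2^p)))
    (Up : ℕ → (Fin w → ℝ) → (Fin w → Fin (2^p)))
    (out : (Fin w → Fin (2^p)) → Bool)
    (hdec : ∀ G : SimpleGraph (Fin (k * N)),
      ((∀ i, out (fpState Msg Up G (fun _ => zeroS w p) (fun _ _ => 0) d i) = true) ↔
        hasCycleOfLength G k)) :
    N * N ≤ p * w * (k * N) * d := by
  classical
  let st : Set (Fin N × Fin N) → Set (Fin N × Fin N) → ℕ → Fin (k * N) → Fin w → Fin (2^p) :=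
    fun X Y => fpState Msg Up (layeredGraph (k := k) X Y) (fun _ => zeroS w p) (fun _ _ => 0)
  have hsub : ∀ X X' : Set (Fin N × Fin N),
      (∀ ℓ < d, st X Xᶜ (ℓ + 1) = st X' X'ᶜ (ℓ + 1)) → X ⊆ X' := by
    intro X X' hst
    have hcross : st X X'ᶜ d = st X Xᶜ d :=
      fpState_eq_of_Nstar_eq_or (layeredGraph_Nstar_local hk X Xᶜ X' X'ᶜ) hst d le_rfl
    have h1 := (hdec (layeredGraph X X'ᶜ)).trans (hasCycleOfLength_layeredGraph_iff hk hko _ _)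
    have h2 := (hdec (layeredGraph X Xᶜ)).trans (hasCycleOfLength_layeredGraph_iff hk hko _ _)
    change (∀ i, out (st X X'ᶜ d i) = true) ↔ _ at h1
    change (∀ i, out (st X Xᶜ d i) = true) ↔ _ at h2
    rw [hcross, h2, Set.inter_compl_self] at h1
    by_contra hn
    obtain ⟨x, hx, hx'⟩ := Set.not_subset.1 hn
    exact Set.not_nonempty_empty (h1.2 ⟨x, hx, hx'⟩)
  let hist : Set (Fin N × Fin N) → Fin d → Fin (k * N) → Fin w → Fin (2^p) :=
    fun X ℓ => st X Xᶜ (ℓ + 1)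
  have hinj : Function.Injective hist := by
    intro X X' h
    have hst : ∀ ℓ < d, st X Xᶜ (ℓ + 1) = st X' X'ᶜ (ℓ + 1) := fun ℓ hℓ => congrFun h ⟨ℓ, hℓ⟩
    exact (hsub _ _ hst).antisymm (hsub _ _ fun ℓ hℓ => (hst ℓ hℓ).symm)
  have hcard := Fintype.card_le_of_injective hist hinj
  simp only [Fintype.card_set, Fintype.card_prod, Fintype.card_fin, Fintype.card_fun] at hcard
  rw [← pow_mul, ← pow_mul, ← pow_mul] at hcard
  simpa only [mul_assoc] using (Nat.pow_le_pow_iff_right one_lt_two).1 hcard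

/-- **Odd-cycle detection lower bound.**  For every odd `k ≥ 5` there is a constant
`c > 0` such that for infinitely many `n`, every finite-precision message-passing GNN of
depth `d`, width `w`, and precision `p ≥ 1` that decides the predicate "`G` contains a
`k`-cycle" over all `n`-node inputs with identically-zero node and edge attributes
satisfies `d · (w·p + ⌈log₂ n⌉) ≥ c · n`. -/
theorem odd_cycle_detection_lower_bound (k : ℕ) (hk : 5 ≤ k) (hko : Odd k) :
    ∃ c : ℝ, 0 < c ∧
      {n : ℕ |
        ∀ d w p : ℕ, 1 ≤ p →
        ∀ (Msg : ℕ → (Fin w → Fin (2^p)) × (Fin w → Fin (2^p)) × Fin n × Fin n × ℕ →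
              (Fin w → Fin (2^p)))
          (Up : ℕ → (Fin w → ℝ) → (Fin w → Fin (2^p)))
          (out : (Fin w → Fin (2^p)) → Bool),
          (∀ G : SimpleGraph (Fin n),
            ((∀ i, out (fpState Msg Up G (fun _ => zeroS w p) (fun _ _ => 0) d i) = true) ↔
              hasCycleOfLength G k)) →
          c * (n : ℝ) ≤ (d * (w * p + Nat.clog 2 n) : ℝ) }.Infinite := by
  have hk0 : (0 : ℝ) < k := by exact_mod_cast (show 0 < k by omega)
  refine ⟨1 / (k : ℝ) ^ 2, by positivity, ?_⟩
  refine (Set.infinite_range_of_injective (f := fun N : ℕ => k * (N + 1)) ?_).mono ?_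
  · intro M N h
    simpa [show k ≠ 0 by omega] using h
  rintro _ ⟨N, rfl⟩ d w p - Msg Up out hdec
  have h1 := sq_le_of_decides_cycle hk hko Msg Up out hdec
  have h2 : N + 1 ≤ p * w * k * d := by
    refine Nat.le_of_mul_le_mul_right (h1.trans_eq ?_) N.succ_pos
    ring
  have h3 : ((N : ℝ) + 1) ≤ p * w * k * d := by exact_mod_cast h2
  have h4 : (0 : ℝ) ≤ d * Nat.clog 2 (k * (N + 1)) := by positivity
  have h5 : 1 / (k : ℝ) ^ 2 * ((k * (N + 1) : ℕ) : ℝ) = (N + 1) / k := by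
    push_cast
    field_simp
  rw [h5, div_le_iff₀ hk0]
  nlinarith
end

section
/- For every W ∈ ℕ there exists a constant c > 0 such that for infinitely many n ∈ ℕ the following holds: for all d, p ∈ ℕ with p ≥ 1 and all w ≤ W, every finite-precision message-passing GNN of depth d, width w, and precision p that solves the minimum vertex cover problem on all n-node inputs with identically-zero attributes satisfies d · (w·p + ⌈log₂ n⌉) · ⌈log₂ n⌉ ≥ c · n². (NP-hard problem lower bound: for constant-width networks, exactly solving minimum vertex cover requires dw = Ω(n² / log² n), even with unbounded per-layer computation.) -/
/-- `C` is a vertex cover of `G`: every edge of `G` has at least one endpoint in `C`. -/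
def IsVertexCoverFinset {n : ℕ} (G : SimpleGraph (Fin n)) (C : Finset (Fin n)) : Prop :=
  ∀ i j : Fin n, G.Adj i j → i ∈ C ∨ j ∈ C

/-- `τ(G)`, the minimum cardinality of a vertex cover of `G`. -/
noncomputable def minVertexCoverCard {n : ℕ} (G : SimpleGraph (Fin n)) : ℕ :=
  sInf {m : ℕ | ∃ C : Finset (Fin n), IsVertexCoverFinset G C ∧ C.card = m}

/-- Simulation of a network by two parties: if `G` agrees with `G₁` around the nodes satisfying `P`
and with `G₂` around the others, and the runs on `G₁` and `G₂` have the same states at all nodes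
incident to the cut, then the run on `G` is obtained by gluing these two runs. -/
lemma fpState_glue {n w p : ℕ}
    (Msg : ℕ → (Fin w → Fin (2^p)) × (Fin w → Fin (2^p)) × Fin n × Fin n × ℕ →
      (Fin w → Fin (2^p)))
    (Up : ℕ → (Fin w → ℝ) → (Fin w → Fin (2^p)))
    (a : Fin n → Fin w → Fin (2^p)) (β : Fin n → Fin n → ℕ)
    {G G₁ G₂ : SimpleGraph (Fin n)} {P B : Fin n → Prop} {d : ℕ}
    (h₁ : ∀ i j, P i → (G.Adj i j ↔ G₁.Adj i j))
    (h₂ : ∀ i j, ¬ P i → (G.Adj i j ↔ G₂.Adj i j))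
    (hB : ∀ i j, G.Adj i j → P i → ¬ P j → B i ∧ B j)
    (hs : ∀ ℓ < d, ∀ j, B j → fpState Msg Up G₁ a β ℓ j = fpState Msg Up G₂ a β ℓ j) :
    ∀ ℓ ≤ d, ∀ i, (P i → fpState Msg Up G a β ℓ i = fpState Msg Up G₁ a β ℓ i) ∧
      (¬ P i → fpState Msg Up G a β ℓ i = fpState Msg Up G₂ a β ℓ i) := by
  intro ℓ
  induction ℓ with
  | zero => intro _ i; exact ⟨fun _ => rfl, fun _ => rfl⟩
  | succ ℓ ih =>
    intro hℓ i
    have ih' := ih (by omega)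
    have hs' := hs ℓ (by omega)
    constructor
    · intro hi
      have hN : Nstar G i = Nstar G₁ i := by ext j; simp [Nstar, h₁ i j hi]
      simp only [fpState]
      rw [← hN]
      congr 1
      refine Finset.sum_congr rfl fun j hj => ?_
      have hj' : fpState Msg Up G a β ℓ j = fpState Msg Up G₁ a β ℓ j := by
        by_cases hPj : P j
        · exact (ih' j).1 hPj
        · have hadj : G.Adj i j := by
            have : j = i ∨ G.Adj i j := by simpa [Nstar] using hj
            exact this.resolve_left fun h => hPj (h ▸ hi)
          rw [(ih' j).2 hPj, hs' j (hB i j hadj hi hPj).2]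
      rw [(ih' i).1 hi, hj']
    · intro hi
      have hN : Nstar G i = Nstar G₂ i := by ext j; simp [Nstar, h₂ i j hi]
      simp only [fpState]
      rw [← hN]
      congr 1
      refine Finset.sum_congr rfl fun j hj => ?_
      have hj' : fpState Msg Up G a β ℓ j = fpState Msg Up G₂ a β ℓ j := by
        by_cases hPj : P j
        · have hadj : G.Adj i j := by
            have : j = i ∨ G.Adj i j := by simpa [Nstar] using hj
            exact this.resolve_left fun h => hi (h ▸ hPj)
          rw [(ih' j).1 hPj, hs' j (hB j i hadj.symm hPj hi).1]
        · exact (ih' j).2 hPj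
      rw [(ih' i).2 hi, hj']

/-- Vertices of the hard instances: a side (Alice or Bob), a row index, and either a clique vertex
labelled by a bit string or a bit-gadget vertex. -/
abbrev HardVertex (m : ℕ) : Type := Bool × Bool × ((Fin m → Bool) ⊕ (Fin m × Bool))

/-- Inputs of one party: which pairs of clique vertices are joined. -/
abbrev HardInput (m : ℕ) : Type := (Fin m → Bool) × (Fin m → Bool) → Bool

/-- Adjacency in the hard instance with inputs `X`. -/
def hardAdj {m : ℕ} (X : Bool → HardInput m) : HardVertex m → HardVertex m → Prop
  | (s, l, .inl x), (s', l', .inl y) =>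
      s = s' ∧ ((l = l' ∧ x ≠ y) ∨ (l = false ∧ l' = true ∧ X s (x, y) = true) ∨
        (l = true ∧ l' = false ∧ X s (y, x) = true))
  | (s, l, .inl x), (s', l', .inr (h, b)) => s = s' ∧ l = l' ∧ x h = b
  | (s, l, .inr (h, b)), (s', l', .inl x) => s = s' ∧ l = l' ∧ x h = b
  | (_, l, .inr (h, b)), (_, l', .inr (h', b')) => l = l' ∧ h = h' ∧ b ≠ b'

/-- The hard instance with inputs `X`. -/
def hardGraph {m : ℕ} (X : Bool → HardInput m) : SimpleGraph (HardVertex m) where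
  Adj := hardAdj X
  symm := ⟨by
    rintro ⟨s, l, x | ⟨h, b⟩⟩ ⟨s', l', y | ⟨h', b'⟩⟩ H <;> simp only [hardAdj] at H ⊢ <;> grind⟩
  loopless := ⟨by
    rintro ⟨s, l, x | ⟨h, b⟩⟩ H <;> simp only [hardAdj] at H <;> grind⟩

/-- The clique or pair of opposite gadget vertices containing a given vertex. -/
def hardSlot {m : ℕ} : HardVertex m → Bool × Bool × Option (Fin m)
  | (s, l, .inl _) => (s, l, none)
  | (s, l, .inr (h, _)) => (s, l, some h)

lemma hardSlot_injOn {m : ℕ} {X : Bool → HardInput m} {I : Finset (HardVertex m)}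
    (hI : ∀ u ∈ I, ∀ v ∈ I, ¬ (hardGraph X).Adj u v) : Set.InjOn hardSlot (I : Set (HardVertex m)) := by
  rintro ⟨s, l, x | ⟨h, b⟩⟩ hu ⟨s', l', y | ⟨h', b'⟩⟩ hv H <;>
    have := hI _ hu _ hv <;> simp only [hardSlot, hardGraph, hardAdj] at H this <;> grind

lemma card_hardSlots (m : ℕ) : Fintype.card (Bool × Bool × Option (Fin m)) = 4 * m + 4 := by
  simp; ring

lemma card_indep_le {m : ℕ} {X : Bool → HardInput m} {I : Finset (HardVertex m)}
    (hI : ∀ u ∈ I, ∀ v ∈ I, ¬ (hardGraph X).Adj u v) : I.card ≤ 4 * m + 4 := by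
  classical
  rw [← Finset.card_image_of_injOn (hardSlot_injOn hI), ← card_hardSlots]
  exact Finset.card_le_univ _

lemma exists_common_nonedge_of_card_indep {m : ℕ} {X : Bool → HardInput m}
    {I : Finset (HardVertex m)} (hI : ∀ u ∈ I, ∀ v ∈ I, ¬ (hardGraph X).Adj u v)
    (hc : I.card = 4 * m + 4) : ∃ q, ∀ s, X s q = false := by
  classical
  have himg : I.image hardSlot = Finset.univ := by
    rw [← Finset.card_eq_iff_eq_univ, Finset.card_image_of_injOn (hardSlot_injOn hI), hc,
      card_hardSlots]
  have hsurj : ∀ t, ∃ u ∈ I, hardSlot u = t := fun t =>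
    Finset.mem_image.1 (himg ▸ Finset.mem_univ t)
  have hx : ∀ s l, ∃ x, ((s, l, .inl x) : HardVertex m) ∈ I := by
    intro s l
    obtain ⟨⟨s', l', x | ⟨h, b⟩⟩, hu, H⟩ := hsurj (s, l, none) <;> simp only [hardSlot] at H
    · exact ⟨x, by grind⟩
    · grind
  have hb : ∀ s l h, ∃ b, ((s, l, .inr (h, b)) : HardVertex m) ∈ I := by
    intro s l h
    obtain ⟨⟨s', l', x | ⟨h', b⟩⟩, hu, H⟩ := hsurj (s, l, some h) <;> simp only [hardSlot] at H
    · grind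
    · exact ⟨b, by grind⟩
  choose x hx using hx
  choose b hb using hb
  have hxb : ∀ s l h, x s l h ≠ b s l h := by
    intro s l h H
    exact hI _ (hx s l) _ (hb s l h) ⟨rfl, rfl, H⟩
  have hbb : ∀ s l h, b s l h = b false l h := by
    intro s l h
    by_contra H
    exact hI _ (hb s l h) _ (hb false l h) ⟨rfl, rfl, H⟩
  have hxx : ∀ s l, x s l = x false l := by
    intro s l
    funext h
    rw [Bool.eq_not.2 (hxb s l h), Bool.eq_not.2 (hxb false l h), hbb s l h]
  refine ⟨(x false false, x false true), fun s => ?_⟩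
  by_contra H
  rw [Bool.not_eq_false] at H
  refine hI _ (hx s false) _ (hx s true) ⟨rfl, Or.inr (Or.inl ⟨rfl, rfl, ?_⟩)⟩
  rw [hxx s false, hxx s true, H]

lemma exists_indep_of_common_nonedge {m : ℕ} {X : Bool → HardInput m}
    {q : (Fin m → Bool) × (Fin m → Bool)} (hq : ∀ s, X s q = false) :
    ∃ I : Finset (HardVertex m), (∀ u ∈ I, ∀ v ∈ I, ¬ (hardGraph X).Adj u v) ∧
      I.card = 4 * m + 4 := by
  classical
  let r : Bool → Fin m → Bool := fun l => bif l then q.2 else q.1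
  let f : Bool × Bool × Option (Fin m) → HardVertex m := fun t =>
    (t.1, t.2.1, t.2.2.elim (.inl (r t.2.1)) fun h => .inr (h, !(r t.2.1 h)))
  have hf : Function.LeftInverse hardSlot f := by
    rintro ⟨s, l, _ | h⟩ <;> rfl
  refine ⟨Finset.univ.image f, ?_, ?_⟩
  · simp only [Finset.mem_image, Finset.mem_univ, true_and, forall_exists_index,
      forall_apply_eq_imp_iff]
    rintro ⟨s, l, _ | h⟩ ⟨s', l', _ | h'⟩
    · rintro ⟨rfl, ⟨rfl, H⟩ | ⟨h₁, h₂, H⟩ | ⟨h₁, h₂, H⟩⟩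
      · exact H rfl
      · dsimp only at h₁ h₂ H
        subst h₁ h₂
        exact Bool.false_ne_true ((hq s).symm.trans H)
      · dsimp only at h₁ h₂ H
        subst h₁ h₂
        exact Bool.false_ne_true ((hq s).symm.trans H)
    · rintro ⟨rfl, H, H'⟩
      dsimp only at H H'
      subst H
      simp at H'
    · rintro ⟨rfl, H, H'⟩
      dsimp only at H H'
      subst H
      simp at H'
    · rintro ⟨H, H', H''⟩
      dsimp only at H H' H''
      subst H H'
      exact H'' rfl
  · rw [Finset.card_image_of_injective _ hf.injective, Finset.card_univ, card_hardSlots]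

/-- The hard instance transported to `Fin n` along a labelling of its vertices. -/
def hardGraphFin {m n : ℕ} (e : Fin n ≃ HardVertex m) (X : Bool → HardInput m) :
    SimpleGraph (Fin n) := (hardGraph X).comap e

lemma indep_compl_of_isVertexCoverFinset {m n : ℕ} {e : Fin n ≃ HardVertex m}
    {X : Bool → HardInput m} {C : Finset (Fin n)}
    (hC : IsVertexCoverFinset (hardGraphFin e X) C) :
    ∀ u ∈ Cᶜ.map e.toEmbedding, ∀ v ∈ Cᶜ.map e.toEmbedding, ¬ (hardGraph X).Adj u v := by
  simp only [Finset.mem_map, Finset.mem_compl, forall_exists_index, and_imp]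
  rintro _ i hi rfl _ j hj rfl H
  exact (hC i j H).elim hi hj

lemma lt_card_add_of_isVertexCoverFinset {m n : ℕ} {e : Fin n ≃ HardVertex m}
    {X : Bool → HardInput m} {C : Finset (Fin n)}
    (hC : IsVertexCoverFinset (hardGraphFin e X) C) (hX : ¬ ∃ q, ∀ s, X s q = false) :
    n < C.card + (4 * m + 4) := by
  have hI := indep_compl_of_isVertexCoverFinset hC
  have h₁ := card_indep_le hI
  have h₂ := mt (exists_common_nonedge_of_card_indep hI) hX
  have h₃ := C.card_add_card_compl
  simp only [Finset.card_map, Fintype.card_fin] at h₁ h₂ h₃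
  omega

lemma minVertexCoverCard_add_le {m n : ℕ} (e : Fin n ≃ HardVertex m)
    {X : Bool → HardInput m} (hX : ∃ q, ∀ s, X s q = false) :
    minVertexCoverCard (hardGraphFin e X) + (4 * m + 4) ≤ n := by
  obtain ⟨q, hq⟩ := hX
  obtain ⟨I, hI, hc⟩ := exists_indep_of_common_nonedge hq
  have hcover : IsVertexCoverFinset (hardGraphFin e X) (I.map e.symm.toEmbedding)ᶜ := by
    intro i j hij
    by_contra! H
    simp only [Finset.mem_compl, not_not, Finset.mem_map_equiv, Equiv.symm_symm] at H
    exact hI _ H.1 _ H.2 hij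
  have hle : minVertexCoverCard (hardGraphFin e X) ≤ (I.map e.symm.toEmbedding)ᶜ.card :=
    Nat.sInf_le ⟨_, hcover, rfl⟩
  have h₃ := (I.map e.symm.toEmbedding).card_add_card_compl
  simp only [Finset.card_map, Fintype.card_fin] at h₃
  omega

/-- The pair of inputs in which Alice has `S` and Bob has `T`. -/
def pairInput {m : ℕ} (S T : HardInput m) : Bool → HardInput m := fun s => bif s then T else S

/-- The labels of the bit-gadget vertices. -/
def gadgetVertex {m : ℕ} (g : Bool × Bool × Fin m × Bool) : HardVertex m :=
  (g.1, g.2.1, .inr g.2.2)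

lemma hardAdj_pairInput_left {m : ℕ} (S T T' : HardInput m) {u : HardVertex m}
    (hu : u.1 = false) (v : HardVertex m) :
    hardAdj (pairInput S T) u v ↔ hardAdj (pairInput S T') u v := by
  obtain ⟨s, l, x | ⟨h, b⟩⟩ := u <;> obtain ⟨s', l', y | ⟨h', b'⟩⟩ := v <;>
    dsimp only at hu <;> subst hu <;> simp [hardAdj, pairInput]

lemma hardAdj_pairInput_right {m : ℕ} (S S' T : HardInput m) {u : HardVertex m}
    (hu : ¬ u.1 = false) (v : HardVertex m) :
    hardAdj (pairInput S T) u v ↔ hardAdj (pairInput S' T) u v := by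
  rw [Bool.not_eq_false] at hu
  obtain ⟨s, l, x | ⟨h, b⟩⟩ := u <;> obtain ⟨s', l', y | ⟨h', b'⟩⟩ := v <;>
    dsimp only at hu <;> subst hu <;> simp [hardAdj, pairInput]

lemma mem_range_gadgetVertex_of_hardAdj {m : ℕ} {X : Bool → HardInput m} {u v : HardVertex m}
    (hadj : hardAdj X u v) (huv : u.1 ≠ v.1) :
    u ∈ Set.range gadgetVertex ∧ v ∈ Set.range gadgetVertex := by
  obtain ⟨s, l, x | ⟨h, b⟩⟩ := u <;> obtain ⟨s', l', y | ⟨h', b'⟩⟩ := v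
  · exact absurd hadj.1 huv
  · exact absurd hadj.1 huv
  · exact absurd hadj.1 huv
  · exact ⟨⟨(s, l, h, b), rfl⟩, ⟨(s', l', h', b'), rfl⟩⟩

/-- A network solving minimum vertex cover on the hard instances has many transcripts. -/
lemma two_pow_le_of_solves {m n d w p : ℕ} (e : Fin n ≃ HardVertex m)
    (Msg : ℕ → (Fin w → Fin (2^p)) × (Fin w → Fin (2^p)) × Fin n × Fin n × ℕ →
      (Fin w → Fin (2^p)))
    (Up : ℕ → (Fin w → ℝ) → (Fin w → Fin (2^p)))
    (out : (Fin w → Fin (2^p)) → Bool)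
    (a : Fin n → Fin w → Fin (2^p)) (β : Fin n → Fin n → ℕ)
    (hsol : ∀ G : SimpleGraph (Fin n),
      IsVertexCoverFinset G (Finset.univ.filter
        (fun i => out (fpState Msg Up G a β d i) = true)) ∧
      (Finset.univ.filter (fun i => out (fpState Msg Up G a β d i) = true)).card
        = minVertexCoverCard G) :
    2 ^ (2 ^ m * 2 ^ m) ≤ 2 ^ (p * w * (8 * m) * d) * (n + 1) := by
  classical
  let H : HardInput m → HardInput m → SimpleGraph (Fin n) := fun S T =>
    hardGraphFin e (pairInput S T)
  let neg : HardInput m → HardInput m := fun S q => !(S q)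
  let sel : SimpleGraph (Fin n) → Finset (Fin n) := fun G =>
    Finset.univ.filter (fun i => out (fpState Msg Up G a β d i) = true)
  let F : HardInput m →
      (Fin d → Bool × Bool × Fin m × Bool → Fin w → Fin (2^p)) × Fin (n + 1) := fun S =>
    (fun ℓ g => fpState Msg Up (H S (neg S)) a β ℓ (e.symm (gadgetVertex g)),
      ⟨((sel (H S (neg S))).filter fun i => (e i).1 = false).card,
        Nat.lt_succ_of_le ((Finset.card_le_univ _).trans_eq (Fintype.card_fin n))⟩)
  have key : ∀ S T, F S = F T → ∀ q, T q = true → S q = true := by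
    intro S T hST q hT
    by_contra hS
    rw [Bool.not_eq_true] at hS
    have htr := congrArg Prod.fst hST
    have hct : ((sel (H S (neg S))).filter fun i => (e i).1 = false).card =
        ((sel (H T (neg T))).filter fun i => (e i).1 = false).card :=
      congrArg (fun z => (Prod.snd z).val) hST
    have hglue := fpState_glue Msg Up a β (G := H S (neg T)) (G₁ := H S (neg S))
      (G₂ := H T (neg T)) (P := fun i => (e i).1 = false)
      (B := fun i => e i ∈ Set.range gadgetVertex) (d := d)
      (fun i j hi => hardAdj_pairInput_left _ _ _ hi _)
      (fun i j hi => hardAdj_pairInput_right _ _ _ hi _)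
      (fun i j hij hi hj => mem_range_gadgetVertex_of_hardAdj hij fun h => hj (h ▸ hi))
      (by
        rintro ℓ hℓ j ⟨g, hg⟩
        have := congrFun (congrFun htr ⟨ℓ, hℓ⟩) g
        simpa only [F, hg, Equiv.symm_apply_apply] using this) d le_rfl
    have hA : (sel (H S (neg T))).filter (fun i => (e i).1 = false) =
        (sel (H S (neg S))).filter fun i => (e i).1 = false := by
      ext i
      simp only [sel, Finset.mem_filter, Finset.mem_univ, true_and]
      exact and_congr_left fun hi => by rw [(hglue i).1 hi]
    have hB : (sel (H S (neg T))).filter (fun i => ¬ (e i).1 = false) =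
        (sel (H T (neg T))).filter fun i => ¬ (e i).1 = false := by
      ext i
      simp only [sel, Finset.mem_filter, Finset.mem_univ, true_and]
      exact and_congr_left fun hi => by rw [(hglue i).2 hi]
    have hcard : (sel (H S (neg T))).card = (sel (H T (neg T))).card := by
      rw [← Finset.card_filter_add_card_filter_not (s := sel (H S (neg T)))
          (fun i => (e i).1 = false),
        ← Finset.card_filter_add_card_filter_not (s := sel (H T (neg T)))
          (fun i => (e i).1 = false), hA, hB, hct]
    have hlow : n < (sel (H T (neg T))).card + (4 * m + 4) := by
      refine lt_card_add_of_isVertexCoverFinset (hsol _).1 ?_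
      rintro ⟨r, hr⟩
      have h₁ := hr false
      have h₂ := hr true
      simp [pairInput, neg] at h₁ h₂
      simp [h₁] at h₂
    have hupp : minVertexCoverCard (H S (neg T)) + (4 * m + 4) ≤ n := by
      refine minVertexCoverCard_add_le e ⟨q, ?_⟩
      rintro (_ | _) <;> simp [pairInput, neg, hS, hT]
    have heq : (sel (H S (neg T))).card = minVertexCoverCard (H S (neg T)) := (hsol _).2
    omega
  have hinj : Function.Injective F := fun S T h =>
    funext fun q => Bool.eq_iff_iff.2 ⟨key T S h.symm q, key S T h q⟩
  have := Fintype.card_le_of_injective F hinj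
  simp only [Fintype.card_prod, Fintype.card_fun, Fintype.card_fin, Fintype.card_bool,
    ← pow_mul] at this
  convert this using 4
  ring

lemma card_hardVertex (m : ℕ) : Fintype.card (HardVertex m) = 4 * 2 ^ m + 8 * m := by
  simp; ring

/-- **Minimum vertex cover lower bound.**  For every width bound `W` there is a constant
`c > 0` such that for infinitely many `n`, every finite-precision message-passing GNN of
depth `d`, width `w ≤ W`, and precision `p ≥ 1` that solves the minimum vertex cover
problem on all `n`-node inputs with identically-zero attributes (the nodes outputting
`true` form a vertex cover of minimum cardinality) satisfies
`d · (w·p + ⌈log₂ n⌉) · ⌈log₂ n⌉ ≥ c · n²`. -/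
theorem minimum_vertex_cover_lower_bound (W : ℕ) :
    ∃ c : ℝ, 0 < c ∧
      {n : ℕ |
        ∀ d p : ℕ, 1 ≤ p → ∀ w : ℕ, w ≤ W →
        ∀ (Msg : ℕ → (Fin w → Fin (2^p)) × (Fin w → Fin (2^p)) × Fin n × Fin n × ℕ →
              (Fin w → Fin (2^p)))
          (Up : ℕ → (Fin w → ℝ) → (Fin w → Fin (2^p)))
          (out : (Fin w → Fin (2^p)) → Bool),
          (∀ G : SimpleGraph (Fin n),
            IsVertexCoverFinset G (Finset.univ.filter
              (fun i => out (fpState Msg Up G (fun _ => zeroS w p) (fun _ _ => 0) d i) = true)) ∧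
            (Finset.univ.filter
              (fun i => out (fpState Msg Up G (fun _ => zeroS w p) (fun _ _ => 0) d i) = true)).card
              = minVertexCoverCard G) →
          c * (n : ℝ)^2 ≤ (d * (w * p + Nat.clog 2 n) * Nat.clog 2 n : ℝ) }.Infinite := by
  refine ⟨1 / 2304, by norm_num, ?_⟩
  have hmono : StrictMono fun m : ℕ => 4 * 2 ^ (m + 3) + 8 * (m + 3) :=
    strictMono_nat_of_lt_succ fun m => by simp only [pow_succ]; omega
  refine (Set.infinite_range_of_injective hmono.injective).mono ?_
  rintro n ⟨k, hn⟩ d p - w - Msg Up out hsol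
  dsimp only at hn
  obtain ⟨m, hm, hm3⟩ : ∃ m, k + 3 = m ∧ 3 ≤ m := ⟨_, rfl, by omega⟩
  rw [hm] at hn
  have hle := two_pow_le_of_solves (Fintype.equivFinOfCardEq ((card_hardVertex m).trans hn)).symm
    Msg Up out _ _ hsol
  have hm2 : m < 2 ^ m := Nat.lt_two_pow_self
  have hn12 : n ≤ 12 * 2 ^ m := by omega
  have hn16 : n + 1 ≤ 2 ^ (m + 4) := by rw [pow_add]; omega
  have hexp : 2 ^ m * 2 ^ m ≤ p * w * (8 * m) * d + (m + 4) := by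
    refine (Nat.pow_le_pow_iff_right (a := 2) (by norm_num)).1 ?_
    rw [pow_add _ _ (m + 4)]
    exact hle.trans (Nat.mul_le_mul_left _ hn16)
  have h8 : 8 ≤ 2 ^ m := by
    calc 8 = 2 ^ 3 := by norm_num
      _ ≤ 2 ^ m := Nat.pow_le_pow_right (by norm_num) hm3
  have hbig : 2 * (m + 4) ≤ 2 ^ m * 2 ^ m := by nlinarith
  have hlog : m ≤ Nat.clog 2 n := by
    have : 2 ^ m ≤ 2 ^ Nat.clog 2 n :=
      le_trans (by omega) (Nat.le_pow_clog (by norm_num) n)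
    exact (Nat.pow_le_pow_iff_right (by norm_num)).1 this
  have hmain : n ^ 2 ≤ 2304 * (d * (w * p + Nat.clog 2 n) * Nat.clog 2 n) := by
    calc n ^ 2 ≤ (12 * 2 ^ m) ^ 2 := Nat.pow_le_pow_left hn12 2
      _ = 144 * (2 ^ m * 2 ^ m) := by ring
      _ ≤ 144 * (2 * (p * w * (8 * m) * d)) := Nat.mul_le_mul_left _ (by omega)
      _ = 2304 * (d * (w * p) * m) := by ring
      _ ≤ 2304 * (d * (w * p + Nat.clog 2 n) * Nat.clog 2 n) := by gcongr; omega
  have hreal : (n : ℝ) ^ 2 ≤ 2304 * (d * (w * p + Nat.clog 2 n) * Nat.clog 2 n) := by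
    exact_mod_cast hmain
  linarith
end

section
/- For every W ∈ ℕ there exists a constant c > 0 such that for infinitely many n ∈ ℕ the following holds: for all d, p ∈ ℕ with p ≥ 1 and all w ≤ W, every finite-precision message-passing GNN of depth d, width w, and precision p that solves the maximum independent set problem on all n-node inputs with identically-zero attributes satisfies d · (w·p + ⌈log₂ n⌉) · ⌈log₂ n⌉ ≥ c · n². (NP-hard problem lower bound: for constant-width networks, exactly solving maximum independent set requires dw = Ω(n² / log² n), even with unbounded per-layer computation.) -/
/-- `I` is an independent set of `G`: no two elements of `I` are adjacent in `G`. -/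
def IsIndepSetFinset {n : ℕ} (G : SimpleGraph (Fin n)) (I : Finset (Fin n)) : Prop :=
  ∀ i ∈ I, ∀ j ∈ I, ¬ G.Adj i j

/-- `α(G)`, the maximum cardinality of an independent set of `G`. -/
noncomputable def maxIndepSetCard {n : ℕ} (G : SimpleGraph (Fin n)) : ℕ :=
  sSup {m : ℕ | ∃ I : Finset (Fin n), IsIndepSetFinset G I ∧ I.card = m}

theorem mem_Nstar {n : ℕ} (G : SimpleGraph (Fin n)) (i j : Fin n) :
    j ∈ Nstar G i ↔ j = i ∨ G.Adj i j := by
  simp [Nstar]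

theorem card_le_maxIndepSetCard {n : ℕ} (G : SimpleGraph (Fin n)) (I : Finset (Fin n))
    (hI : IsIndepSetFinset G I) : I.card ≤ maxIndepSetCard G := by
  refine le_csSup ⟨n, ?_⟩ ⟨I, hI, rfl⟩
  rintro _ ⟨J, -, rfl⟩
  simpa using J.card_le_univ

/-- If `H` is glued from two graphs along a partition of the nodes into two sides, every edge of
`H` leaving a side ends in `C`, and the two runs agree on `C` in all layers below `d`, then the run
on `H` restricts on each side to the run on the corresponding graph. -/
theorem fpState_glue_s16 {n w p : ℕ}
    (Msg : ℕ → (Fin w → Fin (2^p)) × (Fin w → Fin (2^p)) × Fin n × Fin n × ℕ →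
      (Fin w → Fin (2^p)))
    (Up : ℕ → (Fin w → ℝ) → (Fin w → Fin (2^p)))
    (a : Fin n → Fin w → Fin (2^p)) (β : Fin n → Fin n → ℕ)
    (H : SimpleGraph (Fin n)) (G : Bool → SimpleGraph (Fin n)) (side : Fin n → Bool)
    (C : Set (Fin n)) (d : ℕ)
    (hadj : ∀ i j, H.Adj i j ↔ (G (side i)).Adj i j)
    (hcut : ∀ i j, H.Adj i j → side j = side i ∨ j ∈ C)
    (hagree : ∀ ℓ < d, ∀ j ∈ C, ∀ σ τ,
      fpState Msg Up (G σ) a β ℓ j = fpState Msg Up (G τ) a β ℓ j) :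
    ∀ ℓ ≤ d, ∀ i, fpState Msg Up H a β ℓ i = fpState Msg Up (G (side i)) a β ℓ i := by
  intro ℓ
  induction ℓ with
  | zero => intro _ i; rfl
  | succ ℓ ih =>
    intro hℓ i
    have hN : Nstar H i = Nstar (G (side i)) i := by
      ext j; simp only [mem_Nstar, hadj]
    simp only [fpState]
    rw [← hN]
    congr 1
    refine Finset.sum_congr rfl fun j hj => ?_
    have hi := ih (by omega) i
    have hstj : fpState Msg Up H a β ℓ j = fpState Msg Up (G (side i)) a β ℓ j := by
      rw [ih (by omega) j]
      rcases (mem_Nstar H i j).1 hj with rfl | h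
      · rfl
      · rcases hcut i j h with h | h
        · rw [h]
        · exact hagree ℓ (by omega) j h _ _
    rw [hi, hstj]

/-- Nodes of the lower-bound graph: a side, one of two index copies, and either an index in
`Fin L → Bool` or a bit node recording a position and the value of the bit there. -/
abbrev BitNode (L : ℕ) : Type := Bool × Bool × ((Fin L → Bool) ⊕ (Fin L × Bool))

/-- Adjacency of the lower-bound graph. On each side and copy the index nodes form a clique, an
index node is joined to the bit nodes contradicting it, bit nodes for the same position with
different values are joined across sides, and `m σ` lists the pairs of index nodes from the
two copies that are joined on side `σ`. -/
def bitAdj {L : ℕ} (m : Bool → Set ((Fin L → Bool) × (Fin L → Bool))) :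
    BitNode L → BitNode L → Prop
  | (σ, s, .inl i), (τ, t, .inl j) => σ = τ ∧ ((s = t ∧ i ≠ j) ∨
      (s = false ∧ t = true ∧ (i, j) ∈ m σ) ∨ (s = true ∧ t = false ∧ (j, i) ∈ m σ))
  | (σ, s, .inl i), (τ, t, .inr (h, b)) => σ = τ ∧ s = t ∧ i h ≠ b
  | (σ, s, .inr (h, b)), (τ, t, .inl i) => σ = τ ∧ s = t ∧ i h ≠ b
  | (_, s, .inr (h, b)), (_, t, .inr (k, c)) => s = t ∧ h = k ∧ b ≠ c

/-- The lower-bound graph with joined pairs `m`. -/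
def bitGraph {L : ℕ} (m : Bool → Set ((Fin L → Bool) × (Fin L → Bool))) :
    SimpleGraph (BitNode L) where
  Adj := bitAdj m
  symm := ⟨by
    rintro ⟨σ, s, i | ⟨h, b⟩⟩ ⟨τ, t, j | ⟨h', b'⟩⟩ hadj <;> simp only [bitAdj] at hadj ⊢ <;>
      grind⟩
  loopless := ⟨by
    rintro ⟨σ, s, i | ⟨h, b⟩⟩ hadj <;> simp only [bitAdj] at hadj <;> grind⟩

theorem bitAdj_congr {L : ℕ} {m m' : Bool → Set ((Fin L → Bool) × (Fin L → Bool))}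
    (u v : BitNode L) (h : m u.1 = m' u.1) : bitAdj m u v ↔ bitAdj m' u v := by
  rcases u with ⟨σ, s, i | ⟨h, b⟩⟩ <;> rcases v with ⟨τ, t, j | ⟨h', b'⟩⟩ <;>
    simp_all [bitAdj]

theorem bitAdj_cut {L : ℕ} {m : Bool → Set ((Fin L → Bool) × (Fin L → Bool))}
    {u v : BitNode L} (h : bitAdj m u v) :
    v.1 = u.1 ∨ ∃ c : Bool × Bool × Fin L × Bool, v = (c.1, c.2.1, .inr c.2.2) := by
  rcases u with ⟨σ, s, i | ⟨h, b⟩⟩ <;> rcases v with ⟨τ, t, j | ⟨h', b'⟩⟩ <;>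
    simp_all [bitAdj]

/-- The clique or bit position a node belongs to; an independent set has at most one node
in each of them. -/
def bitSlot {L : ℕ} : BitNode L → Bool × Bool × (Unit ⊕ Fin L)
  | (σ, s, .inl _) => (σ, s, .inl ())
  | (σ, s, .inr (h, _)) => (σ, s, .inr h)

/-- The node in a given slot that is consistent with the choice `i` of an index for each copy. -/
def bitSection {L : ℕ} (i : Bool → Fin L → Bool) : Bool × Bool × (Unit ⊕ Fin L) → BitNode L
  | (σ, s, .inl _) => (σ, s, .inl (i s))
  | (σ, s, .inr h) => (σ, s, .inr (h, i s h))

theorem bitSection_injective {L : ℕ} (i : Bool → Fin L → Bool) :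
    Function.Injective (bitSection i) := by
  rintro ⟨σ, s, _ | h⟩ ⟨τ, t, _ | h'⟩ heq <;> simp_all [bitSection]

theorem bitSection_not_adj {L : ℕ} {m : Bool → Set ((Fin L → Bool) × (Fin L → Bool))}
    (i : Bool → Fin L → Bool) {q r : Bool × Bool × (Unit ⊕ Fin L)}
    (h : (i false, i true) ∈ m q.1 →
      q ≠ (q.1, false, .inl ()) ∧ r ≠ (q.1, false, .inl ())) :
    ¬ bitAdj m (bitSection i q) (bitSection i r) := by
  rcases q with ⟨σ, s, _ | a⟩ <;> rcases r with ⟨τ, t, _ | b⟩ <;>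
    simp only [bitAdj, bitSection] <;> grind

theorem card_slots (L : ℕ) : Fintype.card (Bool × Bool × (Unit ⊕ Fin L)) = 4 * L + 4 := by
  simp; ring

theorem card_lt_of_indep {L : ℕ} {m : Bool → Set ((Fin L → Bool) × (Fin L → Bool))}
    (hm : ∀ q, q ∈ m false ∨ q ∈ m true) (I : Finset (BitNode L))
    (hI : ∀ u ∈ I, ∀ v ∈ I, ¬ bitAdj m u v) : I.card < 4 * L + 4 := by
  classical
  have hinj : Set.InjOn (bitSlot (L := L)) I := by
    intro u hu v hv huv
    have h := hI u hu v hv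
    rcases u with ⟨σ, s, i | ⟨h, b⟩⟩ <;> rcases v with ⟨τ, t, j | ⟨h', b'⟩⟩ <;>
      simp only [bitSlot, bitAdj] at * <;> grind
  rw [← Finset.card_image_of_injOn hinj, ← card_slots]
  by_contra! hcard
  have himg := (Finset.card_eq_iff_eq_univ _).1 (le_antisymm (Finset.card_le_univ _) hcard)
  have hrow : ∀ σ s, ∃ i, ((σ, s, .inl i) : BitNode L) ∈ I := by
    intro σ s
    have h := Finset.mem_univ ((σ, s, .inl ()) : Bool × Bool × (Unit ⊕ Fin L))
    rw [← himg, Finset.mem_image] at h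
    obtain ⟨⟨τ, t, i | ⟨a, b⟩⟩, hu, h⟩ := h <;> simp [bitSlot] at h
    obtain ⟨rfl, rfl⟩ := h
    exact ⟨i, hu⟩
  have hbit : ∀ σ s a, ∃ b, ((σ, s, .inr (a, b)) : BitNode L) ∈ I := by
    intro σ s a
    have h := Finset.mem_univ ((σ, s, .inr a) : Bool × Bool × (Unit ⊕ Fin L))
    rw [← himg, Finset.mem_image] at h
    obtain ⟨⟨τ, t, i | ⟨a', b⟩⟩, hu, h⟩ := h <;> simp [bitSlot] at h
    obtain ⟨rfl, rfl, rfl⟩ := h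
    exact ⟨b, hu⟩
  choose i hi using hrow
  choose b hb using hbit
  have hib : ∀ σ s a, i σ s a = b σ s a := by
    intro σ s a
    by_contra hne
    exact hI _ (hi σ s) _ (hb σ s a) ⟨rfl, rfl, hne⟩
  have hsides : ∀ s, i false s = i true s := by
    intro s
    ext1 a
    rw [hib, hib]
    by_contra hne
    exact hI _ (hb false s a) _ (hb true s a) ⟨rfl, rfl, hne⟩
  have hfree : ∀ σ, (i σ false, i σ true) ∉ m σ := fun σ hmem =>
    hI _ (hi σ false) _ (hi σ true) ⟨rfl, .inr (.inl ⟨rfl, rfl, hmem⟩)⟩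
  have h0 := hfree false
  rw [hsides, hsides] at h0
  exact (hm _).elim h0 (hfree true)

theorem card_le_maxIndepSetCard_comap {n L : ℕ} (e : Fin n ≃ BitNode L)
    (m : Bool → Set ((Fin L → Bool) × (Fin L → Bool))) (i : Bool → Fin L → Bool)
    (R : Finset (Bool × Bool × (Unit ⊕ Fin L)))
    (hR : ∀ σ, (i false, i true) ∈ m σ → (σ, false, .inl ()) ∉ R) :
    R.card ≤ maxIndepSetCard ((bitGraph m).comap e) := by
  classical
  have hinj : Function.Injective fun q => e.symm (bitSection i q) :=
    e.symm.injective.comp (bitSection_injective i)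
  rw [← Finset.card_image_of_injective R hinj]
  apply card_le_maxIndepSetCard
  intro u hu v hv
  obtain ⟨q, hq, rfl⟩ := Finset.mem_image.1 hu
  obtain ⟨r, hr, rfl⟩ := Finset.mem_image.1 hv
  have h := bitSection_not_adj (m := m) i (q := q) (r := r) fun hmem =>
    ⟨fun h => hR _ hmem (h ▸ hq), fun h => hR _ hmem (h ▸ hr)⟩
  simpa [bitGraph] using h

theorem le_maxIndepSetCard_of_free {n L : ℕ} (e : Fin n ≃ BitNode L)
    (m : Bool → Set ((Fin L → Bool) × (Fin L → Bool))) (q : (Fin L → Bool) × (Fin L → Bool))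
    (hq : ∀ σ, q ∉ m σ) : 4 * L + 4 ≤ maxIndepSetCard ((bitGraph m).comap e) := by
  rw [← card_slots, ← Finset.card_univ]
  exact card_le_maxIndepSetCard_comap e m (fun s => cond s q.2 q.1) _
    fun σ h => absurd h (hq σ)

theorem le_maxIndepSetCard_of_free_side {n L : ℕ} (e : Fin n ≃ BitNode L)
    (m : Bool → Set ((Fin L → Bool) × (Fin L → Bool))) (q : (Fin L → Bool) × (Fin L → Bool))
    (σ : Bool) (hq : q ∉ m σ) : 4 * L + 3 ≤ maxIndepSetCard ((bitGraph m).comap e) := by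
  classical
  have h := card_le_maxIndepSetCard_comap e m (fun s => cond s q.2 q.1)
    (Finset.univ.erase (!σ, false, .inl ())) (by
      intro τ hτ
      have : τ = !σ := by
        by_contra hne
        obtain rfl : τ = σ := by cases τ <;> cases σ <;> simp_all
        exact hq hτ
      simp [this])
  rw [Finset.card_erase_of_mem (Finset.mem_univ _), Finset.card_univ, card_slots] at h
  simpa using h

/-- The joined pairs encoding `x` on the first and `y` on the second side, such that a pair is free
on both sides exactly if it lies in `x` but not in `y`. -/
def encodePairs {α : Type*} (x y : Set α) : Bool → Set α := fun σ => cond σ y xᶜ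

/-- A network solving maximum independent set on the lower-bound graphs must distinguish all
inputs by the states of the bit nodes, up to one further bit. -/
theorem pow_card_le_of_solves {n L d w p : ℕ} (e : Fin n ≃ BitNode L)
    (Msg : ℕ → (Fin w → Fin (2^p)) × (Fin w → Fin (2^p)) × Fin n × Fin n × ℕ →
      (Fin w → Fin (2^p)))
    (Up : ℕ → (Fin w → ℝ) → (Fin w → Fin (2^p)))
    (out : (Fin w → Fin (2^p)) → Bool)
    (a : Fin n → Fin w → Fin (2^p)) (β : Fin n → Fin n → ℕ)
    (hsolve : ∀ G : SimpleGraph (Fin n),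
      IsIndepSetFinset G (Finset.univ.filter (fun i => out (fpState Msg Up G a β d i) = true)) ∧
      (Finset.univ.filter (fun i => out (fpState Msg Up G a β d i) = true)).card
        = maxIndepSetCard G) :
    4 ^ L ≤ d * (w * p) * (8 * L) + 1 := by
  classical
  let K := (Fin L → Bool) × (Fin L → Bool)
  let o : K := (fun _ => false, fun _ => false)
  let G : Set K → Set K → SimpleGraph (Fin n) := fun x y => (bitGraph (encodePairs x y)).comap e
  let run : Set K → Set K → ℕ → Fin n → Fin w → Fin (2^p) := fun x y => fpState Msg Up (G x y) a β
  let node : Bool × Bool × Fin L × Bool → Fin n := fun c => e.symm (c.1, c.2.1, .inr c.2.2)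
  let T : Set K → (Fin d → (Bool × Bool × Fin L × Bool) → Fin w → Fin (2^p)) × Prop :=
    fun x => (fun ℓ c => run x x ℓ (node c), o ∈ x)
  have hT : Function.Injective T := by
    intro x y hxy
    have hst : ∀ ℓ < d, ∀ c, run x x ℓ (node c) = run y y ℓ (node c) := fun ℓ hℓ c =>
      congrFun (congrFun (congrArg Prod.fst hxy) ⟨ℓ, hℓ⟩) c
    have ho : o ∈ x ↔ o ∈ y := iff_of_eq (congrArg Prod.snd hxy)
    have hglue : ∀ x y : Set K, (∀ ℓ < d, ∀ c, run x x ℓ (node c) = run y y ℓ (node c)) →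
        ∀ i, run x y d i = bif (e i).1 then run y y d i else run x x d i := by
      intro x y hst i
      have h := fpState_glue_s16 Msg Up a β (G x y) (fun σ => bif σ then G y y else G x x)
        (fun i => (e i).1) (Set.range node) d
        (by
          intro i j
          have hσ : ∀ σ, encodePairs x y σ = encodePairs (cond σ y x) (cond σ y x) σ := by
            rintro (_ | _) <;> rfl
          have := bitAdj_congr (e i) (e j) (hσ (e i).1)
          cases hs : (e i).1 <;> rw [hs] at this <;> exact this)
        (by
          intro i j hij
          rcases bitAdj_cut (show bitAdj _ (e i) (e j) from hij) with h | ⟨c, hc⟩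
          · exact .inl h
          · exact .inr ⟨c, by simp only [node]; rw [← hc, e.symm_apply_apply]⟩)
        (by
          rintro ℓ hℓ _ ⟨c, rfl⟩ (_ | _) (_ | _)
          · rfl
          · exact hst ℓ hℓ c
          · exact (hst ℓ hℓ c).symm
          · rfl) d le_rfl i
      cases hs : (e i).1 <;> simp only [hs] at h <;> exact h
    have hsum : maxIndepSetCard (G x y) + maxIndepSetCard (G y x)
        = maxIndepSetCard (G x x) + maxIndepSetCard (G y y) := by
      have hcount : ∀ x y, maxIndepSetCard (G x y) =
          ∑ i, if out (run x y d i) = true then 1 else 0 :=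
        fun x y => by rw [← (hsolve (G x y)).2, Finset.card_filter]
      simp only [hcount, ← Finset.sum_add_distrib]
      refine Finset.sum_congr rfl fun i _ => ?_
      rw [hglue x y hst i, hglue y x (fun ℓ hℓ c => (hst ℓ hℓ c).symm) i]
      cases (e i).1
      · rfl
      · exact add_comm _ _
    have hdiag : ∀ x, maxIndepSetCard (G x x) < 4 * L + 4 := by
      intro x
      rw [← (hsolve (G x x)).2, ← Finset.card_map e.toEmbedding]
      refine card_lt_of_indep (m := encodePairs x x) (fun q => (em (q ∈ x)).symm) _ ?_
      intro u hu v hv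
      obtain ⟨i, hi, rfl⟩ := Finset.mem_map.1 hu
      obtain ⟨j, hj, rfl⟩ := Finset.mem_map.1 hv
      exact (hsolve (G x x)).1 i hi j hj
    have hlow : ∀ x y : Set K, (o ∈ x ↔ o ∈ y) → 4 * L + 3 ≤ maxIndepSetCard (G x y) := by
      intro x y ho
      by_cases h : o ∈ x
      · exact le_maxIndepSetCard_of_free_side e _ o false (fun hmem => hmem h)
      · exact le_maxIndepSetCard_of_free_side e _ o true (fun hmem => h (ho.2 hmem))
    have hsub : ∀ x y : Set K, maxIndepSetCard (G x y) < 4 * L + 4 → x ⊆ y := by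
      intro x y hlt q hqx
      by_contra hqy
      refine absurd (le_maxIndepSetCard_of_free e (encodePairs x y) q ?_) (not_le.2 hlt)
      rintro (_ | _)
      · exact fun hmem => hmem hqx
      · exact hqy
    have h1 := hdiag x
    have h2 := hdiag y
    have h3 := hlow x y ho
    have h4 := hlow y x ho.symm
    exact Set.Subset.antisymm (hsub x y (by omega)) (hsub y x (by omega))
  have hcard := Fintype.card_le_of_injective T hT
  have hK : Fintype.card (Set K) = 2 ^ 4 ^ L := by
    simp only [K, Fintype.card_set, Fintype.card_prod, Fintype.card_fun, Fintype.card_bool,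
      Fintype.card_fin, ← mul_pow]
    norm_num
  have hS : Fintype.card ((Fin d → (Bool × Bool × Fin L × Bool) → Fin w → Fin (2^p)) × Prop)
      = 2 ^ (d * (w * p) * (8 * L) + 1) := by
    simp only [Fintype.card_prod, Fintype.card_fun, Fintype.card_bool, Fintype.card_fin,
      Fintype.card_prop, ← pow_mul]
    rw [pow_succ]
    ring_nf
  rw [hK, hS] at hcard
  exact (Nat.pow_le_pow_iff_right (by norm_num)).1 hcard

theorem card_bitNode (L : ℕ) : Fintype.card (BitNode L) = 4 * (2 ^ L + 2 * L) := by
  simp; ring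

/-- **Maximum independent set lower bound.**  For every width bound `W` there is a
constant `c > 0` such that for infinitely many `n`, every finite-precision
message-passing GNN of depth `d`, width `w ≤ W`, and precision `p ≥ 1` that solves the
maximum independent set problem on all `n`-node inputs with identically-zero attributes
(the nodes outputting `true` form an independent set of maximum cardinality) satisfies
`d · (w·p + ⌈log₂ n⌉) · ⌈log₂ n⌉ ≥ c · n²`. -/
theorem maximum_independent_set_lower_bound (W : ℕ) :
    ∃ c : ℝ, 0 < c ∧
      {n : ℕ |
        ∀ d p : ℕ, 1 ≤ p → ∀ w : ℕ, w ≤ W →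
        ∀ (Msg : ℕ → (Fin w → Fin (2^p)) × (Fin w → Fin (2^p)) × Fin n × Fin n × ℕ →
              (Fin w → Fin (2^p)))
          (Up : ℕ → (Fin w → ℝ) → (Fin w → Fin (2^p)))
          (out : (Fin w → Fin (2^p)) → Bool),
          (∀ G : SimpleGraph (Fin n),
            IsIndepSetFinset G (Finset.univ.filter
              (fun i => out (fpState Msg Up G (fun _ => zeroS w p) (fun _ _ => 0) d i) = true)) ∧
            (Finset.univ.filter
              (fun i => out (fpState Msg Up G (fun _ => zeroS w p) (fun _ _ => 0) d i) = true)).card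
              = maxIndepSetCard G) →
          c * (n : ℝ)^2 ≤ (d * (w * p + Nat.clog 2 n) * Nat.clog 2 n : ℝ) }.Infinite := by
  refine ⟨1 / 2304, by norm_num, Set.infinite_of_injective_forall_mem
    (f := fun L : ℕ => 4 * (2 ^ (L + 1) + 2 * (L + 1))) ?_ ?_⟩
  · refine StrictMono.injective (strictMono_nat_of_lt_succ fun L => ?_)
    have : 2 ^ (L + 1 + 1) = 2 * 2 ^ (L + 1) := by ring
    have := Nat.pos_of_ne_zero (pow_ne_zero (L + 1) (two_ne_zero (α := ℕ)))
    omega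
  · intro L'
    obtain ⟨L, hL⟩ : ∃ L, L = L' + 1 := ⟨_, rfl⟩
    rw [← hL]
    generalize hn : 4 * (2 ^ L + 2 * L) = n
    intro d p _ w _ Msg Up out hsolve
    have e : Fin n ≃ BitNode L :=
      (Fintype.equivFinOfCardEq ((card_bitNode L).trans hn)).symm
    have hmain := pow_card_le_of_solves e Msg Up out _ _ hsolve
    have hlt : L < 2 ^ L := Nat.lt_two_pow_self
    have hclog : L ≤ Nat.clog 2 n := by
      have h := Nat.clog_mono_right 2 (show 2 ^ L ≤ n by omega)
      rwa [Nat.clog_pow 2 L (by norm_num)] at h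
    have h4 : 4 ^ L = 2 ^ L * 2 ^ L := by rw [← mul_pow]; norm_num
    have hL2 : 2 ≤ 2 ^ L := by omega
    have hn' : n ≤ 12 * 2 ^ L := by omega
    have hsq : n ^ 2 ≤ 144 * 4 ^ L := by
      rw [h4]; nlinarith
    have hbig : 4 ≤ 4 ^ L := by rw [h4]; nlinarith
    have hprod : d * (w * p) * L ≤ d * (w * p + Nat.clog 2 n) * Nat.clog 2 n := by
      gcongr
      omega
    have hle : n ^ 2 ≤ 2304 * (d * (w * p + Nat.clog 2 n) * Nat.clog 2 n) := by
      have : d * (w * p) * (8 * L) = 8 * (d * (w * p) * L) := by ring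
      omega
    have hle' : (n : ℝ) ^ 2 ≤ 2304 * (d * (w * p + Nat.clog 2 n) * Nat.clog 2 n) := by
      exact_mod_cast hle
    linarith
end

section
/- There exists a constant c > 0 such that for infinitely many n ∈ ℕ the following holds: for all d, w, p ∈ ℕ with p ≥ 1, every finite-precision message-passing GNN of depth d, width w, and precision p that, for some out : S → ℕ, on every n-node connected input with identically-zero attributes outputs the common value diam(G), satisfies d · (w·p + ⌈log₂ n⌉) ≥ c · n. (Diameter computation lower bound: dw = Ω(n / log n).) -/
namespace SimpleGraph

variable {U V W : Type*}

/-- The graph obtained from `P` by adding a vertex `none` adjacent to all others. -/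
def cone (P : SimpleGraph U) : SimpleGraph (Option U) where
  Adj a b := a ≠ b ∧ ∀ u ∈ a, ∀ v ∈ b, P.Adj u v
  symm := ⟨fun _ _ h => ⟨h.1.symm, fun u hu v hv => (h.2 v hv u hu).symm⟩⟩
  loopless := ⟨fun _ h => h.1 rfl⟩

/-- The cones over `P` and `Q`, joined by the perfect matching between equal vertices. -/
def conePrism (P Q : SimpleGraph U) : SimpleGraph (Bool × Option U) where
  Adj x y := (x.1 = y.1 ∧ (cond x.1 Q P).cone.Adj x.2 y.2) ∨ (x.1 ≠ y.1 ∧ x.2 = y.2)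
  symm := ⟨by
    rintro ⟨s, a⟩ ⟨t, b⟩ (⟨h, hab⟩ | ⟨hst, hab⟩)
    · cases h
      exact Or.inl ⟨rfl, hab.symm⟩
    · exact Or.inr ⟨hst.symm, hab.symm⟩⟩
  loopless := ⟨fun x h => h.elim (fun h => h.2.ne rfl) (fun h => h.1 rfl)⟩

theorem conePrism_adj_none (P Q : SimpleGraph U) (s : Bool) (u : U) :
    (conePrism P Q).Adj (s, some u) (s, none) :=
  Or.inl ⟨rfl, by simp [cone]⟩

theorem conePrism_connected (P Q : SimpleGraph U) : (conePrism P Q).Connected := by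
  have reach_side (s : Bool) (a : Option U) : (conePrism P Q).Reachable (s, a) (s, none) := by
    cases a with
    | none => rfl
    | some u => exact (conePrism_adj_none P Q s u).reachable
  have reach_center (x : Bool × Option U) : (conePrism P Q).Reachable x (false, none) := by
    obtain ⟨s, a⟩ := x
    cases s with
    | false => exact reach_side false a
    | true =>
      refine (reach_side true a).trans (Adj.reachable (Or.inr ?_))
      simp
  exact ⟨fun x y => (reach_center x).trans (reach_center y).symm⟩

theorem ediam_le_two_iff {G : SimpleGraph V} :
    G.ediam ≤ 2 ↔ ∀ u v, u = v ∨ G.Adj u v ∨ ∃ w, G.Adj u w ∧ G.Adj v w := by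
  rw [ediam_le_iff]
  refine forall₂_congr fun u v => ?_
  rw [← not_lt, two_lt_edist_iff, ← Set.not_nonempty_iff_eq_empty]
  simp only [Set.Nonempty, mem_commonNeighbors]
  grind

theorem ediam_comap_equiv_le_two_iff (e : V ≃ W) (G : SimpleGraph W) :
    (G.comap e).ediam ≤ 2 ↔ G.ediam ≤ 2 := by
  rw [ediam_le_two_iff, ediam_le_two_iff]
  refine e.forall_congr fun u => e.forall_congr fun v => ?_
  simp only [comap_adj, e.apply_eq_iff_eq, e.surjective.exists]

theorem ediam_conePrism_le_two_iff (P Q : SimpleGraph U) :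
    (conePrism P Q).ediam ≤ 2 ↔ P ⊔ Q = ⊤ := by
  rw [ediam_le_two_iff]
  constructor
  · intro h
    ext u v
    rw [sup_adj, top_adj]
    refine ⟨fun h => h.elim Adj.ne Adj.ne, fun huv => ?_⟩
    obtain h | h | ⟨⟨s, a⟩, h₁, h₂⟩ := h (false, some u) (true, some v)
    · simp at h
    · simp [conePrism, huv] at h
    · cases s <;> clear h
      · obtain rfl : some v = a := by simpa [conePrism] using h₂
        exact Or.inl (by simpa [conePrism, cone, huv] using h₁)
      · obtain rfl : some u = a := by simpa [conePrism] using h₁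
        exact Or.inr (by simpa [conePrism, cone, huv, Ne.symm huv, adj_comm] using h₂)
  · rintro h ⟨s, a⟩ ⟨t, b⟩
    by_cases hab : a = b
    · subst hab
      by_cases hst : s = t
      · exact Or.inl (by rw [hst])
      · exact Or.inr (Or.inl (Or.inr ⟨hst, rfl⟩))
    have key : P.cone.Adj a b ∨ Q.cone.Adj a b := by
      rcases a with _ | u
      · simp [cone, hab]
      rcases b with _ | v
      · simp [cone]
      have huv : u ≠ v := fun h => hab (by rw [h])
      have : (P ⊔ Q).Adj u v := h ▸ huv
      simpa [cone, huv] using this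
    by_cases hst : s = t
    · subst hst
      right
      rcases a with _ | u
      · exact Or.inl (Or.inl ⟨rfl, by simpa [cone] using hab⟩)
      rcases b with _ | v
      · exact Or.inl (conePrism_adj_none P Q s u)
      exact Or.inr ⟨(s, none), conePrism_adj_none P Q s u, conePrism_adj_none P Q s v⟩
    · right; right
      have hts : t ≠ s := Ne.symm hst
      obtain ⟨r, hr⟩ : ∃ r : Bool, (cond r Q P).cone.Adj a b :=
        key.elim (fun h => ⟨false, h⟩) (fun h => ⟨true, h⟩)
      by_cases hrs : r = s
      · subst hrs
        exact ⟨(r, b), Or.inl ⟨rfl, hr⟩, Or.inr ⟨hts, rfl⟩⟩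
      · have hrt : r = t := by cases r <;> cases s <;> cases t <;> simp_all
        subst hrt
        exact ⟨(r, a), Or.inr ⟨hst, rfl⟩, Or.inl ⟨rfl, hr.symm⟩⟩

theorem two_pow_choose_two_le_card (m : ℕ) :
    2 ^ m.choose 2 ≤ Nat.card (SimpleGraph (Fin m)) := by
  let f : Set {e : Sym2 (Fin m) // ¬ e.IsDiag} → SimpleGraph (Fin m) :=
    fun s => fromEdgeSet (Subtype.val '' s)
  have f_injective : f.Injective := by
    intro s t hst
    have h := congrArg edgeSet hst
    simp only [f, edgeSet_fromEdgeSet] at h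
    ext ⟨e, he⟩
    simpa [he] using Set.ext_iff.mp h e
  have h := Nat.card_le_card_of_injective f f_injective
  rwa [Nat.card_eq_fintype_card, Fintype.card_set, Sym2.card_subtype_not_diag,
    Fintype.card_fin] at h

end SimpleGraph

section MessagePassing

variable {n w p : ℕ}
  (Msg : ℕ → (Fin w → Fin (2^p)) × (Fin w → Fin (2^p)) × Fin n × Fin n × ℕ →
    (Fin w → Fin (2^p)))
  (Up : ℕ → (Fin w → ℝ) → (Fin w → Fin (2^p)))
  (a : Fin n → Fin w → Fin (2^p)) (β : Fin n → Fin n → ℕ)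

theorem Nstar_congr {G H : SimpleGraph (Fin n)} {i : Fin n}
    (h : ∀ j, G.Adj i j ↔ H.Adj i j) : Nstar G i = Nstar H i := by
  ext j
  simp [Nstar, h]

/-- Cut and paste: if two inputs have the same states up to depth `d`, so does every graph
each of whose neighborhoods is taken from one of the two. -/
theorem fpState_eq_of_Nstar_eq {d : ℕ} {G₁ G₂ H : SimpleGraph (Fin n)}
    (hN : ∀ i, Nstar H i = Nstar G₁ i ∨ Nstar H i = Nstar G₂ i)
    (hs : ∀ ℓ ≤ d, fpState Msg Up G₁ a β ℓ = fpState Msg Up G₂ a β ℓ) :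
    ∀ ℓ ≤ d, fpState Msg Up H a β ℓ = fpState Msg Up G₁ a β ℓ := by
  intro ℓ
  induction ℓ with
  | zero => intro _; rfl
  | succ ℓ ih =>
    intro hℓ
    funext i
    have hH := ih (by omega)
    rcases hN i with h | h
    · rw [fpState, fpState, h, hH]
    · rw [hs (ℓ + 1) hℓ, fpState, fpState, h, hH, hs ℓ (by omega)]

/-- The states of all nodes in rounds `1, …, d`. -/
noncomputable def fpHistory (d : ℕ) (G : SimpleGraph (Fin n)) :
    Fin d → Fin n → Fin w → Fin (2^p) :=
  fun ℓ => fpState Msg Up G a β (ℓ + 1)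

variable {Msg Up a β} in
theorem fpState_eq_of_fpHistory_eq {d : ℕ} {G₁ G₂ : SimpleGraph (Fin n)}
    (h : fpHistory Msg Up a β d G₁ = fpHistory Msg Up a β d G₂) :
    ∀ ℓ ≤ d, fpState Msg Up G₁ a β ℓ = fpState Msg Up G₂ a β ℓ
  | 0, _ => rfl
  | ℓ + 1, hℓ => congrFun h ⟨ℓ, hℓ⟩

variable {Msg Up a β} in
theorem le_of_fpHistory_conePrism_compl_eq {U : Type*} {d : ℕ}
    {out : (Fin w → Fin (2^p)) → ℕ}
    (hout : ∀ G : SimpleGraph (Fin n), G.Connected →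
      ∀ i, out (fpState Msg Up G a β d i) = G.diam)
    (e : Fin n ≃ Bool × Option U) {P Q : SimpleGraph U}
    (h : fpHistory Msg Up a β d ((P.conePrism Pᶜ).comap e) =
      fpHistory Msg Up a β d ((Q.conePrism Qᶜ).comap e)) : Q ≤ P := by
  have connected (A B : SimpleGraph U) : ((A.conePrism B).comap e).Connected :=
    (SimpleGraph.Iso.comap e _).connected_iff.mpr (A.conePrism_connected B)
  have ediam_ne_top (A B : SimpleGraph U) : ((A.conePrism B).comap e).ediam ≠ ⊤ := by
    have := (connected A B).nonempty
    exact SimpleGraph.connected_iff_ediam_ne_top.mp (connected A B)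
  have hN (i : Fin n) :
      Nstar ((P.conePrism Qᶜ).comap e) i = Nstar ((P.conePrism Pᶜ).comap e) i ∨
      Nstar ((P.conePrism Qᶜ).comap e) i = Nstar ((Q.conePrism Qᶜ).comap e) i := by
    cases hi : (e i).1 with
    | false => exact Or.inl (Nstar_congr fun j => by simp [SimpleGraph.conePrism, hi])
    | true => exact Or.inr (Nstar_congr fun j => by simp [SimpleGraph.conePrism, hi])
  have hstate := fpState_eq_of_Nstar_eq Msg Up a β hN (fpState_eq_of_fpHistory_eq h) d le_rfl
  have hdiam : ((P.conePrism Qᶜ).comap e).diam = ((P.conePrism Pᶜ).comap e).diam := by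
    rw [← hout _ (connected _ _) (e.symm (false, none)), hstate, hout _ (connected _ _)]
  have hediam : ((P.conePrism Qᶜ).comap e).ediam = ((P.conePrism Pᶜ).comap e).ediam := by
    rw [← ENat.natCast_toNat (ediam_ne_top P Qᶜ), ← ENat.natCast_toNat (ediam_ne_top P Pᶜ)]
    exact congrArg Nat.cast hdiam
  have hsup : P ⊔ Qᶜ = ⊤ := by
    rw [← SimpleGraph.ediam_conePrism_le_two_iff, ← SimpleGraph.ediam_comap_equiv_le_two_iff e,
      hediam, SimpleGraph.ediam_comap_equiv_le_two_iff,
      SimpleGraph.ediam_conePrism_le_two_iff, sup_compl_eq_top]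
  rwa [← codisjoint_iff, codisjoint_iff_compl_le_left, compl_compl] at hsup

variable {Msg Up a β} in
theorem choose_two_le_of_computes_diam {m d : ℕ}
    {out : (Fin w → Fin (2^p)) → ℕ}
    (hout : ∀ G : SimpleGraph (Fin n), G.Connected →
      ∀ i, out (fpState Msg Up G a β d i) = G.diam)
    (hn : n = 2 * (m + 1)) : m.choose 2 ≤ p * w * n * d := by
  let e : Fin n ≃ Bool × Option (Fin m) := Fintype.equivOfCardEq (by simp [hn])
  have history_injective : Function.Injective fun P : SimpleGraph (Fin m) =>
      fpHistory Msg Up a β d ((P.conePrism Pᶜ).comap e) := fun P Q h =>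
    le_antisymm (le_of_fpHistory_conePrism_compl_eq hout e h.symm)
      (le_of_fpHistory_conePrism_compl_eq hout e h)
  have hcard := (SimpleGraph.two_pow_choose_two_le_card m).trans
    (Nat.card_le_card_of_injective _ history_injective)
  simp only [Nat.card_eq_fintype_card, Fintype.card_fun, Fintype.card_fin, ← pow_mul] at hcard
  exact (Nat.pow_le_pow_iff_right (by norm_num)).mp hcard

end MessagePassing

/-- **Diameter computation lower bound.**  There is a constant `c > 0` such that for
infinitely many `n`, every finite-precision message-passing GNN of depth `d`, width `w`,
and precision `p ≥ 1` that, on every `n`-node connected input with identically-zero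
attributes, has every node output the value `diam(G)`, satisfies
`d · (w·p + ⌈log₂ n⌉) ≥ c · n`. -/
theorem diameter_computation_lower_bound :
    ∃ c : ℝ, 0 < c ∧
      {n : ℕ |
        ∀ d w p : ℕ, 1 ≤ p →
        ∀ (Msg : ℕ → (Fin w → Fin (2^p)) × (Fin w → Fin (2^p)) × Fin n × Fin n × ℕ →
              (Fin w → Fin (2^p)))
          (Up : ℕ → (Fin w → ℝ) → (Fin w → Fin (2^p)))
          (out : (Fin w → Fin (2^p)) → ℕ),
          (∀ G : SimpleGraph (Fin n), G.Connected →
            ∀ i, out (fpState Msg Up G (fun _ => zeroS w p) (fun _ _ => 0) d i) = G.diam) →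
          c * (n : ℝ) ≤ (d * (w * p + Nat.clog 2 n) : ℝ) }.Infinite := by
  refine ⟨1 / 36, by norm_num, Set.infinite_of_injective_forall_mem (f := fun k => 2 * (k + 3))
    (fun k l h => by simpa using h) fun k => ?_⟩
  intro d w p _ Msg Up out hout
  have h : (k + 2).choose 2 ≤ p * w * (2 * (k + 3)) * d :=
    choose_two_le_of_computes_diam hout rfl
  have hreal : (((k + 2).choose 2 : ℕ) : ℝ) ≤ p * w * (2 * (k + 3)) * d := mod_cast h
  rw [Nat.cast_choose_two] at hreal
  push_cast at hreal ⊢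
  have hk : (0 : ℝ) ≤ k := k.cast_nonneg
  have hlin : 1 / 36 * (2 * ((k : ℝ) + 3)) ≤ d * (w * p) := by
    have hpos : (0 : ℝ) < 2 * (k + 3) := by positivity
    refine le_of_mul_le_mul_left ?_ hpos
    nlinarith
  have hlog : (0 : ℝ) ≤ d * Nat.clog 2 (2 * (k + 3)) := by positivity
  linarith
end

section
/- There exists a constant c > 0 such that for infinitely many n ∈ ℕ the following holds: for all d, w, p ∈ ℕ with p ≥ 1, every finite-precision message-passing GNN of depth d, width w, and precision p that, for some out : S → ℕ, on every n-node connected input with identically-zero attributes whose graph contains at least one cycle outputs a common value v satisfying girth(G) ≤ v ≤ 2·girth(G), satisfies d · (w·p + ⌈log₂ n⌉) ≥ c · √n. (Girth 2-approximation lower bound: dw = Ω(√n / log n).) -/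
/-- The path on `Fin n` together with the chord joining `0` and `k`. -/
def chordedPath (n k : ℕ) : SimpleGraph (Fin n) :=
  SimpleGraph.pathGraph n ⊔ SimpleGraph.fromRel (fun i j => i.val = 0 ∧ j.val = k)

theorem chordedPath_adj {n k : ℕ} {i j : Fin n} :
    (chordedPath n k).Adj i j ↔ (i.val + 1 = j.val ∨ j.val + 1 = i.val) ∨
      (i ≠ j ∧ ((i.val = 0 ∧ j.val = k) ∨ (j.val = 0 ∧ i.val = k))) := by
  simp [chordedPath, SimpleGraph.pathGraph_adj]

theorem chordedPath_connected {n : ℕ} (k : ℕ) (hn : 0 < n) : (chordedPath n k).Connected := by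
  obtain ⟨m, rfl⟩ := Nat.exists_eq_add_one.mpr hn
  exact (SimpleGraph.pathGraph_connected m).mono le_sup_left

theorem chordedPath_not_isAcyclic {n k : ℕ} (hk : 2 ≤ k) (hkn : k < n) :
    ¬ (chordedPath n k).IsAcyclic := by
  intro h
  have hadj : (chordedPath n k).Adj ⟨0, by omega⟩ ⟨k, hkn⟩ := by
    simp [chordedPath_adj]
    omega
  refine SimpleGraph.isAcyclic_iff_forall_adj_isBridge.mp h hadj ?_
  refine (SimpleGraph.pathGraph_preconnected n _ _).mono fun i j hij => ?_
  rw [SimpleGraph.deleteEdges_adj]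
  refine ⟨Or.inl hij, ?_⟩
  rw [SimpleGraph.pathGraph_adj] at hij
  simp only [Set.mem_singleton_iff, Sym2.eq_iff, Fin.ext_iff]
  omega

/-- Every vertex of a cycle has two distinct neighbours on the cycle. -/
theorem SimpleGraph.Walk.IsCycle.exists_two_adj {V : Type*} {G : SimpleGraph V} {u v : V}
    {p : G.Walk u u} (hp : p.IsCycle) (hv : v ∈ p.support) :
    ∃ a ∈ p.support, ∃ b ∈ p.support, a ≠ b ∧ G.Adj v a ∧ G.Adj v b := by
  obtain ⟨a, b, hab, h⟩ := Set.ncard_eq_two.mp (hp.ncard_neighborSet_toSubgraph_eq_two hv)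
  have key : ∀ x ∈ p.toSubgraph.neighborSet v, x ∈ p.support ∧ G.Adj v x := fun x hx =>
    ⟨p.mem_verts_toSubgraph.mp (p.toSubgraph.edge_vert (p.toSubgraph.adj_symm hx)),
      p.toSubgraph.adj_sub hx⟩
  obtain ⟨ha, hva⟩ := key a (by simp [h])
  obtain ⟨hb, hvb⟩ := key b (by simp [h])
  exact ⟨a, ha, b, hb, hab, hva, hvb⟩

theorem lt_length_of_isCycle_chordedPath {n k : ℕ} {u : Fin n}
    {p : (chordedPath n k).Walk u u} (hp : p.IsCycle) : k < p.length := by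
  obtain ⟨m, hm, hmax⟩ := p.support.toFinset.exists_max_image (fun i => i.val)
    ⟨u, by simp⟩
  simp only [List.mem_toFinset] at hm hmax
  have hmk : m.val = k := by
    obtain ⟨a, ha, b, hb, hab, hma, hmb⟩ := hp.exists_two_adj hm
    have := hmax a ha
    have := hmax b hb
    rw [chordedPath_adj] at hma hmb
    simp only [ne_eq, Fin.ext_iff] at *
    omega
  have hmem : ∀ j ≤ k, ∃ x ∈ p.support, x.val + j = k := by
    intro j
    induction j with
    | zero => exact fun _ => ⟨m, hm, hmk⟩
    | succ j ih =>
      intro hj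
      obtain ⟨x, hx, hxk⟩ := ih (by omega)
      obtain ⟨a, ha, b, hb, hab, hxa, hxb⟩ := hp.exists_two_adj hx
      have := hmax a ha
      have := hmax b hb
      rw [chordedPath_adj] at hxa hxb
      simp only [ne_eq, Fin.ext_iff] at *
      by_cases h : a.val + (j + 1) = k
      · exact ⟨a, ha, h⟩
      · exact ⟨b, hb, by omega⟩
  have hsub : Finset.range (k + 1) ⊆ p.support.tail.toFinset.image (fun i => i.val) := by
    intro i hi
    rw [Finset.mem_range] at hi
    obtain ⟨x, hx, hxk⟩ := hmem (k - i) (by omega)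
    refine Finset.mem_image.mpr ⟨x, ?_, by omega⟩
    rw [List.mem_toFinset]
    rcases (p.mem_support_iff).mp hx with rfl | h
    · exact SimpleGraph.Walk.end_mem_tail_support hp.not_nil
    · exact h
  calc k + 1 = (Finset.range (k + 1)).card := by simp
    _ ≤ _ := Finset.card_le_card hsub
    _ ≤ _ := Finset.card_image_le
    _ ≤ _ := List.toFinset_card_le _
    _ = p.length := by simp

theorem lt_girth_chordedPath {n k : ℕ} (hk : 2 ≤ k) (hkn : k < n) :
    k < (chordedPath n k).girth := by
  obtain ⟨_, p, hp, h⟩ := SimpleGraph.exists_girth_eq_length.mpr (chordedPath_not_isAcyclic hk hkn)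
  exact h ▸ lt_length_of_isCycle_chordedPath hp

theorem girth_chordedPath_two_le {n : ℕ} (hn : 2 < n) : (chordedPath n 2).girth ≤ 3 := by
  have h : (chordedPath n 2).IsNClique 3
      {⟨0, by omega⟩, ⟨1, by omega⟩, ⟨2, hn⟩} := by
    rw [SimpleGraph.is3Clique_triple_iff]
    simp [chordedPath_adj]
  obtain ⟨_, p, hp, hlen⟩ :=
    SimpleGraph.is3Clique_iff_exists_cycle_length_three.mp ⟨_, h⟩
  exact hlen ▸ SimpleGraph.girth_le_length hp

/-- After `ℓ` rounds, states of nodes at distance more than `ℓ` from the part where two path-like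
graphs differ coincide. -/
theorem fpState_eq_of_adj_iff {n w p m : ℕ}
    (Msg : ℕ → (Fin w → Fin (2^p)) × (Fin w → Fin (2^p)) × Fin n × Fin n × ℕ →
      (Fin w → Fin (2^p)))
    (Up : ℕ → (Fin w → ℝ) → (Fin w → Fin (2^p)))
    {G H : SimpleGraph (Fin n)} (a : Fin n → Fin w → Fin (2^p)) (β : Fin n → Fin n → ℕ)
    (hGH : ∀ i j : Fin n, m < i.val → (G.Adj i j ↔ H.Adj i j))
    (hG : ∀ i j : Fin n, m < i.val → G.Adj i j → i.val ≤ j.val + 1)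
    (ℓ : ℕ) (i : Fin n) (hi : m + ℓ < i.val) :
    fpState Msg Up G a β ℓ i = fpState Msg Up H a β ℓ i := by
  induction ℓ generalizing i with
  | zero => rfl
  | succ ℓ ih =>
    have hN : Nstar G i = Nstar H i := by
      ext j
      simp [Nstar, hGH i j (by omega)]
    simp only [fpState]
    rw [← hN, ih i (by omega)]
    congr 1
    refine Finset.sum_congr rfl fun j hj => ?_
    have hij : i.val ≤ j.val + 1 := by
      simp only [Nstar, Finset.mem_filter, Finset.mem_univ, true_and] at hj
      rcases hj with rfl | hj
      · omega
      · exact hG i j (by omega) hj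
    rw [ih j (by omega)]

/-- **Girth `2`-approximation lower bound.**  There is a constant `c > 0` such that for
infinitely many `n`, every finite-precision message-passing GNN of depth `d`, width `w`,
and precision `p ≥ 1` that, on every `n`-node connected input with identically-zero
attributes whose graph contains at least one cycle, outputs a common value `v` with
`girth(G) ≤ v ≤ 2·girth(G)`, satisfies `d · (w·p + ⌈log₂ n⌉) ≥ c · √n`. -/
theorem girth_approximation_lower_bound :
    ∃ c : ℝ, 0 < c ∧
      {n : ℕ |
        ∀ d w p : ℕ, 1 ≤ p →
        ∀ (Msg : ℕ → (Fin w → Fin (2^p)) × (Fin w → Fin (2^p)) × Fin n × Fin n × ℕ →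
              (Fin w → Fin (2^p)))
          (Up : ℕ → (Fin w → ℝ) → (Fin w → Fin (2^p)))
          (out : (Fin w → Fin (2^p)) → ℕ),
          (∀ G : SimpleGraph (Fin n), G.Connected → ¬ G.IsAcyclic →
            ∃ v : ℕ,
              (∀ i, out (fpState Msg Up G (fun _ => zeroS w p) (fun _ _ => 0) d i) = v) ∧
              G.girth ≤ (v : ℕ∞) ∧ (v : ℕ∞) ≤ 2 * G.girth) →
          c * Real.sqrt n ≤ (d * (w * p + Nat.clog 2 n) : ℝ) }.Infinite := by
  refine ⟨1 / 2, by norm_num, Set.infinite_of_forall_exists_gt fun N => ⟨N + 16, ?_, by omega⟩⟩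
  intro d w p _ Msg Up out hout
  generalize hn : N + 16 = n at *
  have hd : n ≤ d + 7 := by
    by_contra! hlt
    obtain ⟨v, hv, -, hv_le⟩ := hout (chordedPath n 2) (chordedPath_connected 2 (by omega))
      (chordedPath_not_isAcyclic le_rfl (by omega))
    obtain ⟨u, hu, hu_ge, -⟩ := hout (chordedPath n 6) (chordedPath_connected 6 (by omega))
      (chordedPath_not_isAcyclic (by omega) (by omega))
    have heq := fpState_eq_of_adj_iff (m := 6) Msg Up (G := chordedPath n 2)
      (H := chordedPath n 6) (fun _ => zeroS w p) (fun _ _ => 0)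
      (fun i j hi => by simp only [chordedPath_adj]; omega)
      (fun i j hi h => by rw [chordedPath_adj] at h; omega)
      d ⟨n - 1, by omega⟩ (by simp only; omega)
    have huv : u = v := by rw [← hu ⟨n - 1, by omega⟩, ← heq, hv]
    have h3 := girth_chordedPath_two_le (n := n) (by omega)
    have h7 := lt_girth_chordedPath (n := n) (k := 6) (by omega) (by omega)
    norm_cast at hv_le hu_ge
    omega
  have hlog : 1 ≤ Nat.clog 2 n := Nat.clog_pos (by norm_num) (by omega)
  have hle : n ≤ 2 * (d * (w * p + Nat.clog 2 n)) := by
    have := Nat.le_mul_of_pos_right d (show 0 < w * p + Nat.clog 2 n by omega)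
    omega
  have hsqrt : Real.sqrt n ≤ n := by
    refine Real.sqrt_le_iff.mpr ⟨n.cast_nonneg, ?_⟩
    exact_mod_cast Nat.le_self_pow two_ne_zero n
  have hle' : (n : ℝ) ≤ 2 * (d * (w * p + Nat.clog 2 n)) := by exact_mod_cast hle
  linarith
end
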